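/- arXiv:1907.13253 — 2 statements merged into one kernel-verified Lean document; each statement's English description precedes it below -/
import Mathlib

section
/- Let θ1 = φ1∘λ on Sⁿ with φ1 symmetric convex piecewise affine, and let X̄ ∈ Sⁿ. Define T^lin_{θ1}(X̄) := {H ∈ Sⁿ : θ1'(X̄;H) = −θ1'(X̄;−H)}. Then H ∈ T^lin_{θ1}(X̄) if and only if ⟨λ'(X̄;H), aⁱ − aʲ⟩ = 0 for all i, j ∈ ι1(λ(X̄)). Moreover, if H ∈ T^lin_{θ1}(X̄), then there exist scalars ρ̂_l, for each l in Ẽ := {l ∈ {1,…,r} : there exist i,j ∈ α^l with (a^w)_i ≠ (a^w)_j for some w ∈ ι1(λ(X̄))}, such that Ūᵀ_{α^l} H Ū_{α^l} = ρ̂_l I_{|α^l|} for every Ū ∈ 𝕆ⁿ(X̄). -/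
open Matrix Filter Topology Set
open scoped Classical

noncomputable section

/-- The vector of eigenvalues of a symmetric matrix, in non-increasing order. -/
noncomputable def lamVec {n : ℕ} (X : Matrix (Fin n) (Fin n) ℝ) : Fin n → ℝ :=
  if h : X.IsHermitian then fun i => (h.eigenvalues ∘ Tuple.sort h.eigenvalues) i.rev else 0

/-- The set `𝕆ⁿ(X)` of orthogonal matrices giving an ordered eigenvalue decomposition of `X`. -/
def OSet {n : ℕ} (X : Matrix (Fin n) (Fin n) ℝ) : Set (Matrix (Fin n) (Fin n) ℝ) :=
  {U | Uᵀ * U = 1 ∧ X = U * Matrix.diagonal (lamVec X) * Uᵀ}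

/-- One-sided directional derivative of a scalar function. -/
noncomputable def dirDeriv {E : Type*} [AddCommMonoid E] [Module ℝ E] (f : E → ℝ) (x h : E) : ℝ :=
  limUnder (𝓝[>] (0:ℝ)) fun t => (f (x + t • h) - f x) / t

/-- Vector of one-sided directional derivatives of the ordered eigenvalues: `λ'(X;H)`. -/
noncomputable def lamDD {n : ℕ} (X H : Matrix (Fin n) (Fin n) ℝ) : Fin n → ℝ :=
  fun i => dirDeriv (fun Y => lamVec Y i) X H

/-- The max-of-affine convex piecewise affine function `φ(x) = max_i (⟨aⁱ,x⟩ - cᵢ)`. -/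
noncomputable def pwa {n p : ℕ} [NeZero p] (a : Fin p → Fin n → ℝ) (c : Fin p → ℝ)
    (x : Fin n → ℝ) : ℝ :=
  ⨆ i, (a i ⬝ᵥ x - c i)

/-- The active index set `ι(x̄)` of a max-of-affine function at `x̄`. -/
def iotaA {n p : ℕ} [NeZero p] (a : Fin p → Fin n → ℝ) (c : Fin p → ℝ)
    (x : Fin n → ℝ) : Set (Fin p) :=
  {i | a i ⬝ᵥ x - c i = pwa a c x}

/-- Frobenius inner product of two matrices. -/
def mip {n : ℕ} (A B : Matrix (Fin n) (Fin n) ℝ) : ℝ := (Aᵀ * B).trace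

/-- Convex subdifferential (over the space of symmetric matrices) of a real function. -/
def msubdiff {n : ℕ} (f : Matrix (Fin n) (Fin n) ℝ → ℝ) (X : Matrix (Fin n) (Fin n) ℝ) :
    Set (Matrix (Fin n) (Fin n) ℝ) :=
  {G | G.IsSymm ∧ ∀ Y : Matrix (Fin n) (Fin n) ℝ, Y.IsSymm → f X + mip G (Y - X) ≤ f Y}

/-- Moore–Penrose pseudo-inverse, via the four Penrose conditions. -/
noncomputable def mpInv {n : ℕ} (A : Matrix (Fin n) (Fin n) ℝ) : Matrix (Fin n) (Fin n) ℝ :=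
  Classical.epsilon fun B => A * B * A = A ∧ B * A * B = B ∧ (A * B)ᵀ = A * B ∧ (B * A)ᵀ = B * A

/-- The sigma-term function
`Υ_X(Y,H) = 2 ∑_l ⟨Λ(Y)_{αˡαˡ}, Uᵀ_{αˡ} H (X - v̄ₗ I)† H U_{αˡ}⟩` (written as a single sum
over eigenvalue indices). -/
noncomputable def Upsilon {n : ℕ} (X Y U H : Matrix (Fin n) (Fin n) ℝ) : ℝ :=
  2 * ∑ i, lamVec Y i *
    ((Uᵀ * H * mpInv (X - lamVec X i • (1 : Matrix (Fin n) (Fin n) ℝ)) * H * U) i i)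


/-- An orthonormal eigenbasis of `T` that diagonalizes the compressions of `S` to the
eigenspaces of `T`. -/
lemma exists_basis_aux {E : Type*} [NormedAddCommGroup E] [InnerProductSpace ℝ E]
    [FiniteDimensional ℝ E] {n : ℕ} (hn : Module.finrank ℝ E = n) (T S : E →ₗ[ℝ] E)
    (hT : T.IsSymmetric) (hS : S.IsSymmetric) :
    ∃ (b : OrthonormalBasis (Fin n) ℝ E) (l m : Fin n → ℝ),
      (∀ i, T (b i) = l i • b i) ∧
      ∀ i j, l i = l j → inner ℝ (b i) (S (b j)) = if i = j then m i else 0 := by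
  let W : Module.End.Eigenvalues T → Submodule ℝ E := fun μ => Module.End.eigenspace T μ
  let C : ∀ μ, W μ →ₗ[ℝ] W μ := fun μ =>
    ((W μ).orthogonalProjectionOnto : E →ₗ[ℝ] W μ) ∘ₗ S ∘ₗ (W μ).subtype
  have hCi : ∀ μ (x y : W μ), inner ℝ x (C μ y) = inner ℝ (x : E) (S y) := by
    intro μ x y
    simp [C]
  have hC : ∀ μ, (C μ).IsSymmetric := by
    intro μ x y
    rw [hCi, real_inner_comm, hCi, ← hS, real_inner_comm]
  let v : ∀ μ, OrthonormalBasis (Fin (Module.finrank ℝ (W μ))) ℝ (W μ) :=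
    fun μ => (hC μ).eigenvectorBasis rfl
  let b0 := DirectSum.IsInternal.collectedOrthonormalBasis hT.orthogonalFamily_eigenspaces'
    hT.direct_sum_isInternal v
  have hb0 : ∀ a, b0 a = (v a.1 a.2 : E) := by
    intro a
    simp [b0, DirectSum.IsInternal.collectedOrthonormalBasis]
  have hcard : Fintype.card (Σ μ, Fin (Module.finrank ℝ (W μ))) = n := by
    rw [← hn, Module.finrank_eq_card_basis b0.toBasis]
  let e := Fintype.equivFinOfCardEq hcard
  let m0 : (Σ μ, Fin (Module.finrank ℝ (W μ))) → ℝ := fun a => (hC a.1).eigenvalues rfl a.2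
  refine ⟨b0.reindex e, fun i => ((e.symm i).1 : ℝ), fun i => m0 (e.symm i), ?_, ?_⟩
  · intro i
    have h := (v (e.symm i).1 (e.symm i).2).2
    rw [OrthonormalBasis.reindex_apply, hb0]
    exact Module.End.mem_eigenspace_iff.mp h
  · intro i j hij
    obtain ⟨⟨μ, k⟩, rfl⟩ := e.surjective i
    obtain ⟨⟨ν, k'⟩, rfl⟩ := e.surjective j
    simp only [Equiv.symm_apply_apply] at hij
    have : μ = ν := Subtype.ext hij
    subst this
    simp only [OrthonormalBasis.reindex_apply, Equiv.symm_apply_apply, hb0]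
    rw [← hCi, LinearMap.IsSymmetric.apply_eigenvectorBasis]
    have hon := orthonormal_iff_ite.mp (v μ).orthonormal k k'
    rw [real_inner_smul_right]
    change _ * inner ℝ (v μ k) (v μ k') = _
    rw [hon]
    by_cases hk : k = k'
    · subst hk; simp [m0]
    · simp [hk]

lemma exists_frame {n : ℕ} (X H : Matrix (Fin n) (Fin n) ℝ) (hX : X.IsSymm) (hH : H.IsSymm) :
    ∃ (U : Matrix (Fin n) (Fin n) ℝ) (l m : Fin n → ℝ), Uᵀ * U = 1 ∧
      Uᵀ * X * U = diagonal l ∧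
      ∀ i j, l i = l j → (Uᵀ * H * U) i j = if i = j then m i else 0 := by
  have hs : ∀ A : Matrix (Fin n) (Fin n) ℝ, A.IsSymm →
      (Matrix.toEuclideanLin A).IsSymmetric := by
    intro A hA
    rw [Matrix.isSymmetric_toEuclideanLin_iff]
    rw [Matrix.IsHermitian, Matrix.conjTranspose_eq_transpose_of_trivial]
    exact hA
  obtain ⟨b, l, m, h1, h2⟩ := exists_basis_aux (n := n) (by simp) _ _ (hs X hX) (hs H hH)
  let U : Matrix (Fin n) (Fin n) ℝ := Matrix.of fun i j => b j i
  have key : ∀ (A : Matrix (Fin n) (Fin n) ℝ) i j,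
      (Uᵀ * A * U) i j = inner ℝ (b i) (Matrix.toEuclideanLin A (b j)) := by
    intro A i j
    simp only [Matrix.mul_assoc]
    simp only [EuclideanSpace.inner_eq_star_dotProduct, Matrix.mul_apply, U, Matrix.of_apply,
      Matrix.transpose_apply, dotProduct, Matrix.ofLp_toLpLin, Matrix.toLin'_apply, 
      Matrix.mulVec, Pi.star_apply, star_trivial]
    exact Finset.sum_congr rfl fun x _ => mul_comm _ _
  have horth : ∀ i j, inner ℝ (b i) (b j) = if i = j then (1:ℝ) else 0 :=
    orthonormal_iff_ite.mp b.orthonormal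
  refine ⟨U, l, m, ?_, ?_, ?_⟩
  · ext i j
    have := key 1 i j
    simp only [Matrix.mul_one] at this
    rw [this, Matrix.one_apply, ← horth]
    simp
  · ext i j
    rw [key, h1, real_inner_smul_right, horth, Matrix.diagonal_apply]
    by_cases h : i = j <;> simp [h]
  · intro i j hij
    rw [key, h2 i j hij]

/-- The ordered spectral decomposition. -/
lemma lamVec_spec {n : ℕ} (X : Matrix (Fin n) (Fin n) ℝ) (hX : X.IsSymm) :
    Antitone (lamVec X) ∧ ∃ V : Matrix (Fin n) (Fin n) ℝ, Vᵀ * V = 1 ∧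
      X = V * diagonal (lamVec X) * Vᵀ := by
  have h : X.IsHermitian := by
    rw [Matrix.IsHermitian, Matrix.conjTranspose_eq_transpose_of_trivial]
    exact hX
  have hl : lamVec X = fun i => (h.eigenvalues ∘ Tuple.sort h.eigenvalues) i.rev := by
    rw [lamVec, dif_pos h]
  have hVV : (h.eigenvectorUnitary : Matrix (Fin n) (Fin n) ℝ)ᵀ * h.eigenvectorUnitary = 1 := by
    have := Unitary.coe_star_mul_self h.eigenvectorUnitary
    simpa [Matrix.star_eq_conjTranspose, Matrix.conjTranspose_eq_transpose_of_trivial] using this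
  constructor
  · rw [hl]
    intro i j hij
    exact Tuple.monotone_sort h.eigenvalues (Fin.rev_le_rev.mpr hij)
  · set V0 : Matrix (Fin n) (Fin n) ℝ := (h.eigenvectorUnitary).1 with hV0
    let e : Equiv.Perm (Fin n) := Fin.revPerm.trans (Tuple.sort h.eigenvalues)
    have hle : lamVec X = h.eigenvalues ∘ e := by rw [hl]; rfl
    refine ⟨V0.submatrix id e, ?_, ?_⟩
    · ext i j
      have : (V0ᵀ * V0) (e i) (e j) = (1 : Matrix (Fin n) (Fin n) ℝ) (e i) (e j) := by rw [hVV]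
      simpa [Matrix.mul_apply, Matrix.one_apply] using this
    · have hsp := h.spectral_theorem
      rw [Unitary.conjStarAlgAut_apply] at hsp
      have hsp' : X = V0 * diagonal h.eigenvalues * V0ᵀ := by
        conv_lhs => rw [hsp]
        rfl
      conv_lhs => rw [hsp']
      rw [hle]
      ext i j
      rw [Matrix.mul_apply, Matrix.mul_apply]
      simp only [Matrix.mul_diagonal, Matrix.submatrix_apply,
        Matrix.transpose_apply, id, Function.comp]
      exact (Equiv.sum_comp e (fun x => V0 i x * h.eigenvalues x * V0 j x)).symm

lemma quad_conj {n : ℕ} (A S : Matrix (Fin n) (Fin n) ℝ) (y : Fin n → ℝ) :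
    (S *ᵥ y) ⬝ᵥ (A *ᵥ (S *ᵥ y)) = y ⬝ᵥ ((Sᵀ * A * S) *ᵥ y) := by
  rw [← Matrix.mulVec_mulVec, ← Matrix.mulVec_mulVec, Matrix.dotProduct_mulVec y,
    Matrix.vecMul_transpose]

lemma quad_conj_one {n : ℕ} (S : Matrix (Fin n) (Fin n) ℝ) (y : Fin n → ℝ) :
    (S *ᵥ y) ⬝ᵥ (S *ᵥ y) = y ⬝ᵥ ((Sᵀ * S) *ᵥ y) := by
  have := quad_conj 1 S y
  simpa using this

lemma quad_diag {n : ℕ} (d y : Fin n → ℝ) :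
    y ⬝ᵥ (diagonal d *ᵥ y) = ∑ i, d i * (y i * y i) := by
  simp only [dotProduct, Matrix.mulVec_diagonal]
  exact Finset.sum_congr rfl fun i _ => by ring

lemma dot_nonneg {n : ℕ} (y : Fin n → ℝ) : 0 ≤ y ⬝ᵥ y :=
  Finset.sum_nonneg fun i _ => mul_self_nonneg _

lemma quad_bound {n : ℕ} (R : Matrix (Fin n) (Fin n) ℝ) :
    ∃ C : ℝ, 0 ≤ C ∧ ∀ y : Fin n → ℝ, |y ⬝ᵥ (R *ᵥ y)| ≤ C * (y ⬝ᵥ y) := by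
  refine ⟨∑ i, ∑ j, |R i j|, by positivity, fun y => ?_⟩
  have hi : ∀ i, y i * y i ≤ y ⬝ᵥ y := fun i =>
    Finset.single_le_sum (f := fun i => y i * y i) (fun i _ => mul_self_nonneg _)
      (Finset.mem_univ i)
  have hexp : y ⬝ᵥ (R *ᵥ y) = ∑ i, ∑ j, y i * (R i j * y j) := by
    simp only [Matrix.mulVec, dotProduct, Finset.mul_sum]
  rw [hexp, Finset.sum_mul]
  refine (Finset.abs_sum_le_sum_abs _ _).trans ?_
  refine Finset.sum_le_sum fun i _ => (Finset.abs_sum_le_sum_abs _ _).trans ?_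
  rw [Finset.sum_mul]
  refine Finset.sum_le_sum fun j _ => ?_
  have : |y i * (R i j * y j)| = |R i j| * |y i * y j| := by
    rw [← abs_mul]; congr 1; ring
  rw [this]
  refine mul_le_mul_of_nonneg_left ?_ (abs_nonneg _)
  have h1 := hi i
  have h2 := hi j
  rw [abs_le]
  constructor <;> nlinarith [sq_nonneg (y i - y j), sq_nonneg (y i + y j)]

/-- One half of the Courant-Fischer / Weyl comparison. -/
lemma half_weyl {n : ℕ} (A V S : Matrix (Fin n) (Fin n) ℝ) (d : Fin n → ℝ) (e c : ℝ)
    (s t : Finset (Fin n)) (hV : Vᵀ * V = 1) (hA : A = V * diagonal d * Vᵀ)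
    (hcard : n < s.card + t.card) (hd : ∀ i ∈ t, d i ≤ e)
    (hS : ∀ y, S *ᵥ y = 0 → y = 0)
    (hc : ∀ y : Fin n → ℝ, (∀ i, i ∉ s → y i = 0) →
      c * ((S *ᵥ y) ⬝ᵥ (S *ᵥ y)) ≤ (S *ᵥ y) ⬝ᵥ (A *ᵥ (S *ᵥ y))) : c ≤ e := by
  have hV' : V * Vᵀ = 1 := mul_eq_one_comm.mp hV
  let M : Matrix {i // i ∉ t} {i // i ∈ s} ℝ := (Vᵀ * S).submatrix Subtype.val Subtype.val
  have hlt : Module.finrank ℝ ({i // i ∉ t} → ℝ) < Module.finrank ℝ ({i // i ∈ s} → ℝ) := by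
    have h1 : Fintype.card {i // i ∉ t} = n - t.card := by
      rw [Fintype.card_subtype_compl]; simp
    have h2 : Fintype.card {i // i ∈ s} = s.card := by simp
    rw [Module.finrank_fintype_fun_eq_card, Module.finrank_fintype_fun_eq_card, h1, h2]
    have : t.card ≤ n := by simpa using t.card_le_univ
    omega
  obtain ⟨y0, hy0, hy0n⟩ := Submodule.exists_mem_ne_zero_of_ne_bot
    (LinearMap.ker_ne_bot_of_finrank_lt (f := M.mulVecLin) hlt)
  let y : Fin n → ℝ := fun i => if h : i ∈ s then y0 ⟨i, h⟩ else 0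
  have hys : ∀ i, i ∉ s → y i = 0 := fun i hi => by simp [y, hi]
  have hyn : y ≠ 0 := by
    intro h
    apply hy0n
    ext ⟨i, hi⟩
    have := congrFun h i
    simpa [y, hi] using this
  have hz : ∀ i, i ∉ t → (Vᵀ *ᵥ (S *ᵥ y)) i = 0 := by
    intro i hi
    have h1 : (M *ᵥ y0) ⟨i, hi⟩ = 0 := by
      have := LinearMap.mem_ker.mp hy0
      rw [Matrix.mulVecLin_apply] at this
      rw [this]; rfl
    rw [Matrix.mulVec_mulVec, ← h1]
    simp only [Matrix.mulVec, dotProduct, M, Matrix.submatrix_apply]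
    rw [← Finset.sum_subset (Finset.subset_univ s)
      (fun j _ hj => by rw [hys j hj, mul_zero]), ← Finset.sum_coe_sort s]
    refine Finset.sum_congr rfl fun j _ => ?_
    simp [y]
  set x := S *ᵥ y with hx
  have hxn : x ≠ 0 := fun h => hyn (hS y h)
  set z := Vᵀ *ᵥ x with hzdef
  have hxx : x ⬝ᵥ x = ∑ i, z i * z i := by
    have := quad_conj_one Vᵀ x
    rw [Matrix.transpose_transpose, hV', Matrix.one_mulVec] at this
    rw [← this]; rfl
  have hxA : x ⬝ᵥ (A *ᵥ x) = ∑ i, d i * (z i * z i) := by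
    rw [← quad_diag, hzdef, quad_conj (diagonal d) Vᵀ x, Matrix.transpose_transpose, ← hA]
  have hle : x ⬝ᵥ (A *ᵥ x) ≤ e * (x ⬝ᵥ x) := by
    rw [hxA, hxx, Finset.mul_sum]
    refine Finset.sum_le_sum fun i _ => ?_
    by_cases hi : i ∈ t
    · exact mul_le_mul_of_nonneg_right (hd i hi) (mul_self_nonneg _)
    · simp [hz i hi]
  have hpos : 0 < x ⬝ᵥ x := by
    refine lt_of_le_of_ne (dot_nonneg x) (fun h => hxn ?_)
    exact dotProduct_self_eq_zero.mp h.symm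
  exact le_of_mul_le_mul_right ((hc y hys).trans hle) hpos

lemma perturb_lower {n : ℕ} (X H U : Matrix (Fin n) (Fin n) ℝ) (l m : Fin n → ℝ)
    (hH : H.IsSymm) (hU : Uᵀ * U = 1) (hX : Uᵀ * X * U = diagonal l)
    (hG : ∀ i j, l i = l j → (Uᵀ * H * U) i j = if i = j then m i else 0) :
    ∃ C : ℝ, 0 ≤ C ∧ ∀ τ : ℝ, 0 ≤ τ → τ ≤ 1 → ∀ (V : Matrix (Fin n) (Fin n) ℝ) (d : Fin n → ℝ),
      Vᵀ * V = 1 → X + τ • H = V * diagonal d * Vᵀ → ∀ s t : Finset (Fin n),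
      n < s.card + t.card → ∀ k, (∀ i ∈ s, l k + τ * m k ≤ l i + τ * m i) →
      ∀ e, (∀ i ∈ t, d i ≤ e) → l k + τ * m k - C * τ ^ 2 ≤ e := by
  set G := Uᵀ * H * U with hGdef
  have hGs : ∀ i j, G i j = G j i := by
    intro i j
    have : Gᵀ = G := by
      rw [hGdef]
      simp only [Matrix.transpose_mul, Matrix.transpose_transpose, Matrix.mul_assoc]
      rw [show Hᵀ = H from hH]
    conv_lhs => rw [← this]
    rfl
  let K : Matrix (Fin n) (Fin n) ℝ := Matrix.of fun i j => G i j / (l j - l i)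
  have hKT : Kᵀ = -K := by
    ext i j
    simp only [K, Matrix.transpose_apply, Matrix.of_apply, Matrix.neg_apply]
    rw [hGs j i, ← neg_sub (l j) (l i), div_neg]
  have hD : G + diagonal l * K - K * diagonal l = diagonal m := by
    ext i j
    simp only [Matrix.add_apply, Matrix.sub_apply, Matrix.diagonal_mul, Matrix.mul_diagonal,
      Matrix.diagonal_apply, K, Matrix.of_apply]
    by_cases hij : l i = l j
    · rw [hG i j hij, hij]; simp
    · have hne : i ≠ j := fun h => hij (by rw [h])
      have h1 : l j - l i ≠ 0 := sub_ne_zero.mpr (Ne.symm hij)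
      rw [if_neg hne]
      field_simp
      ring
  obtain ⟨C1, hC1, hb1⟩ := quad_bound (G * K - K * G - K * diagonal l * K)
  obtain ⟨C2, hC2, hb2⟩ := quad_bound (K * G * K)
  obtain ⟨C3, hC3, hb3⟩ := quad_bound (K * K)
  set B : ℝ := ∑ i, (|l i| + |m i|) with hB
  have hB0 : 0 ≤ B := by positivity
  refine ⟨C1 + C2 + B * C3, by positivity, ?_⟩
  intro τ hτ0 hτ1 V d hV hA s t hcard k hk e he
  set C := C1 + C2 + B * C3 with hC
  have hSS : (U * (1 + τ • K))ᵀ = (1 - τ • K) * Uᵀ := by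
    rw [Matrix.transpose_mul, Matrix.transpose_add, Matrix.transpose_smul, hKT]
    simp [sub_eq_add_neg]
  have hn1 : ∀ y : Fin n → ℝ, ((U * (1 + τ • K)) *ᵥ y) ⬝ᵥ ((U * (1 + τ • K)) *ᵥ y) =
      y ⬝ᵥ y + τ ^ 2 * ((K *ᵥ y) ⬝ᵥ (K *ᵥ y)) := by
    intro y
    rw [quad_conj_one, quad_conj_one K, hSS, hKT]
    have : (1 - τ • K) * Uᵀ * (U * (1 + τ • K)) = 1 + τ ^ 2 • (-K * K) := by
      calc _ = (1 - τ • K) * (Uᵀ * U) * (1 + τ • K) := by simp only [Matrix.mul_assoc]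
        _ = _ := by
          rw [hU, Matrix.mul_one]
          simp only [Matrix.sub_mul, Matrix.mul_add, Matrix.one_mul, Matrix.mul_one,
            Matrix.smul_mul, Matrix.mul_smul, Matrix.neg_mul, smul_smul, smul_sub, smul_add, pow_two, smul_neg]
          abel
    rw [this, Matrix.add_mulVec, Matrix.one_mulVec, Matrix.smul_mulVec, dotProduct_add,
      dotProduct_smul, smul_eq_mul]
  have hn2 : ∀ y : Fin n → ℝ,
      ((U * (1 + τ • K)) *ᵥ y) ⬝ᵥ ((X + τ • H) *ᵥ ((U * (1 + τ • K)) *ᵥ y)) =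
      y ⬝ᵥ (diagonal l *ᵥ y) + τ * (y ⬝ᵥ (diagonal m *ᵥ y)) +
      τ ^ 2 * (y ⬝ᵥ ((G * K - K * G - K * diagonal l * K) *ᵥ y))
      - τ ^ 3 * (y ⬝ᵥ ((K * G * K) *ᵥ y)) := by
    intro y
    rw [quad_conj, hSS]
    have : (1 - τ • K) * Uᵀ * (X + τ • H) * (U * (1 + τ • K)) =
        diagonal l + τ • diagonal m + τ ^ 2 • (G * K - K * G - K * diagonal l * K)
        - τ ^ 3 • (K * G * K) := by
      calc _ = (1 - τ • K) * (Uᵀ * X * U + τ • (Uᵀ * H * U)) * (1 + τ • K) := by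
            simp only [Matrix.mul_assoc, Matrix.mul_add, Matrix.add_mul, Matrix.mul_smul,
              Matrix.smul_mul]
        _ = _ := by
          rw [hX, ← hGdef, ← hD]
          simp only [Matrix.sub_mul, Matrix.mul_add, Matrix.add_mul, Matrix.mul_sub,
            Matrix.one_mul, Matrix.mul_one,
            Matrix.smul_mul, Matrix.mul_smul, smul_smul, smul_add, smul_sub, pow_succ, pow_zero,
            one_mul, Matrix.mul_assoc, mul_assoc]
          abel
    rw [this]
    simp only [Matrix.sub_mulVec (A := _ + _ + _), Matrix.add_mulVec, Matrix.smul_mulVec,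
      dotProduct_add, dotProduct_sub, dotProduct_smul, smul_eq_mul]
  refine half_weyl (X + τ • H) V (U * (1 + τ • K)) d e _ s t hV hA hcard he ?_ ?_
  · intro y hy
    have := hn1 y
    rw [hy, zero_dotProduct] at this
    have h1 := dot_nonneg y
    have h2 := mul_nonneg (sq_nonneg τ) (dot_nonneg (K *ᵥ y))
    exact dotProduct_self_eq_zero.mp (by linarith)
  · intro y hy
    rw [hn1, hn2]
    have e1 := hb1 y
    have e2 := hb2 y
    have e3 := hb3 y
    have hKK : (K *ᵥ y) ⬝ᵥ (K *ᵥ y) = - (y ⬝ᵥ ((K * K) *ᵥ y)) := by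
      rw [quad_conj_one, hKT, Matrix.neg_mul, Matrix.neg_mulVec, dotProduct_neg]
    have hq0 := dot_nonneg (K *ᵥ y)
    have hy0 := dot_nonneg y
    have hq : (K *ᵥ y) ⬝ᵥ (K *ᵥ y) ≤ C3 * (y ⬝ᵥ y) := by
      rw [hKK]; exact (neg_le_abs _).trans e3
    have hmain : (l k + τ * m k) * (y ⬝ᵥ y) ≤
        y ⬝ᵥ (diagonal l *ᵥ y) + τ * (y ⬝ᵥ (diagonal m *ᵥ y)) := by
      rw [quad_diag, quad_diag, dotProduct, Finset.mul_sum, Finset.mul_sum,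
        ← Finset.sum_add_distrib]
      refine Finset.sum_le_sum fun i _ => ?_
      by_cases hi : i ∈ s
      · nlinarith [mul_le_mul_of_nonneg_right (hk i hi) (mul_self_nonneg (y i))]
      · simp [hy i hi]
    have hlk : l k + τ * m k ≤ B := by
      have h1 : |l k| + |m k| ≤ B :=
        Finset.single_le_sum (f := fun i => |l i| + |m i|) (fun i _ => by positivity)
          (Finset.mem_univ k)
      have h2 : τ * m k ≤ |m k| := by
        calc τ * m k ≤ τ * |m k| := mul_le_mul_of_nonneg_left (le_abs_self _) hτ0
          _ ≤ 1 * |m k| := mul_le_mul_of_nonneg_right hτ1 (abs_nonneg _)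
          _ = _ := one_mul _
      linarith [le_abs_self (l k)]
    have hC0 : 0 ≤ C := by positivity
    set q := (K *ᵥ y) ⬝ᵥ (K *ᵥ y)
    set N := y ⬝ᵥ y
    set r1 := y ⬝ᵥ ((G * K - K * G - K * diagonal l * K) *ᵥ y)
    set r2 := y ⬝ᵥ ((K * G * K) *ᵥ y)
    have f1 : -(C1 * N) ≤ r1 := (abs_le.mp e1).1
    have f2 : r2 ≤ C2 * N := (abs_le.mp e2).2
    have g1 : -(τ ^ 2 * (C1 * N)) ≤ τ ^ 2 * r1 := by nlinarith [sq_nonneg τ]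
    have g2 : τ ^ 3 * r2 ≤ τ ^ 2 * (C2 * N) := by
      have h1 : τ ^ 3 * r2 ≤ τ ^ 3 * (C2 * N) := mul_le_mul_of_nonneg_left f2 (by positivity)
      have h2 : τ ^ 3 ≤ τ ^ 2 := by nlinarith [sq_nonneg τ]
      exact h1.trans (mul_le_mul_of_nonneg_right h2 (by positivity))
    have g3 : (l k + τ * m k - C * τ ^ 2) * (τ ^ 2 * q) ≤ τ ^ 2 * (B * (C3 * N)) := by
      have h1 : l k + τ * m k - C * τ ^ 2 ≤ B := by
        have : 0 ≤ C * τ ^ 2 := by positivity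
        linarith
      have h2 : 0 ≤ τ ^ 2 * q := by positivity
      calc _ ≤ B * (τ ^ 2 * q) := mul_le_mul_of_nonneg_right h1 h2
        _ = τ ^ 2 * (B * q) := by ring
        _ ≤ _ := by gcongr
    have : (l k + τ * m k - C * τ ^ 2) * (N + τ ^ 2 * q) =
      (l k + τ * m k) * N - τ ^ 2 * (C1 * N) - τ ^ 2 * (C2 * N) - τ ^ 2 * (B * (C3 * N))
        + (l k + τ * m k - C * τ ^ 2) * (τ ^ 2 * q) := by
      rw [hC]; ring
    linarith

/-- First order expansion of the ordered eigenvalues along a sorted frame. -/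
lemma perturb_sorted {n : ℕ} (X H U : Matrix (Fin n) (Fin n) ℝ) (l m : Fin n → ℝ)
    (hXs : X.IsSymm) (hH : H.IsSymm) (hU : Uᵀ * U = 1) (hX : Uᵀ * X * U = diagonal l)
    (hG : ∀ i j, l i = l j → (Uᵀ * H * U) i j = if i = j then m i else 0)
    (hsort : ∀ i j, i ≤ j → l j ≤ l i ∧ (l i = l j → m j ≤ m i)) :
    lamVec X = l ∧
      ∀ k, Tendsto (fun t : ℝ => (lamVec (X + t • H) k - lamVec X k) / t) (𝓝[>] 0)
        (𝓝 (m k)) := by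
  obtain ⟨C1, hC1, h1⟩ := perturb_lower X H U l m hH hU hX hG
  obtain ⟨C2, hC2, h2⟩ := perturb_lower (-X) (-H) U (-l) (-m) hH.neg hU
    (by rw [Matrix.mul_neg, Matrix.neg_mul, hX, Matrix.diagonal_neg]; rfl)
    (by
      intro i j hij
      rw [Matrix.mul_neg, Matrix.neg_mul, Matrix.neg_apply, hG i j (by simpa using hij)]
      split_ifs <;> simp)
  have key : ∀ τ : ℝ, 0 ≤ τ → τ ≤ 1 → (∀ i j, i ≤ j → l j + τ * m j ≤ l i + τ * m i) →
      ∀ k, |lamVec (X + τ • H) k - (l k + τ * m k)| ≤ (C1 + C2) * τ ^ 2 := by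
    intro τ hτ0 hτ1 hs k
    have hsym : (X + τ • H).IsSymm := hXs.add (hH.smul τ)
    obtain ⟨hanti, V, hV, hVd⟩ := lamVec_spec _ hsym
    have hk : (k : ℕ) < n := k.2
    have a1 := h1 τ hτ0 hτ1 V _ hV hVd (Finset.Iic k) (Finset.Ici k)
      (by rw [Fin.card_Iic, Fin.card_Ici]; omega) k
      (fun i hi => hs i k (Finset.mem_Iic.mp hi)) (lamVec (X + τ • H) k)
      (fun i hi => hanti (Finset.mem_Ici.mp hi))
    have a2 := h2 τ hτ0 hτ1 V (-lamVec (X + τ • H)) hV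
      (by
        have : diagonal (-lamVec (X + τ • H)) = - diagonal (lamVec (X + τ • H)) := by
          rw [Matrix.diagonal_neg]; rfl
        rw [this, Matrix.mul_neg, Matrix.neg_mul, ← hVd, smul_neg, neg_add])
      (Finset.Ici k) (Finset.Iic k)
      (by rw [Fin.card_Iic, Fin.card_Ici]; omega) k
      (fun i hi => by
        have := hs k i (Finset.mem_Ici.mp hi)
        simp only [Pi.neg_apply, mul_neg]; linarith) (-lamVec (X + τ • H) k)
      (fun i hi => by
        have := hanti (Finset.mem_Iic.mp hi)
        simp only [Pi.neg_apply]; linarith)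
    simp only [Pi.neg_apply, mul_neg] at a2
    have b1 : 0 ≤ C1 * τ ^ 2 := by positivity
    have b2 : 0 ≤ C2 * τ ^ 2 := by positivity
    rw [abs_le, add_mul]
    constructor <;> linarith
  have hl : lamVec X = l := by
    ext k
    have := key 0 le_rfl zero_le_one (fun i j hij => by simpa using (hsort i j hij).1) k
    simp only [zero_smul, add_zero, zero_mul] at this
    have h0 : |lamVec X k - l k| ≤ 0 := by simpa using this
    exact sub_eq_zero.mp (abs_nonpos_iff.mp h0)
  refine ⟨hl, fun k => ?_⟩
  have hev : ∀ᶠ τ in 𝓝[>] (0:ℝ), ∀ i j, i ≤ j → l j + τ * m j ≤ l i + τ * m i := by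
    rw [eventually_all]; intro i
    rw [eventually_all]; intro j
    by_cases hij : i ≤ j
    · rcases (hsort i j hij).1.lt_or_eq with h | h
      · have hc1 : Tendsto (fun τ : ℝ => l j + τ * m j) (𝓝[>] 0) (𝓝 (l j)) := by
          have : Continuous (fun τ : ℝ => l j + τ * m j) := by fun_prop
          simpa using (this.tendsto 0).mono_left nhdsWithin_le_nhds
        have hc2 : Tendsto (fun τ : ℝ => l i + τ * m i) (𝓝[>] 0) (𝓝 (l i)) := by
          have : Continuous (fun τ : ℝ => l i + τ * m i) := by fun_prop
          simpa using (this.tendsto 0).mono_left nhdsWithin_le_nhds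
        filter_upwards [hc1.eventually_lt hc2 h] with τ hτ _ using hτ.le
      · filter_upwards [self_mem_nhdsWithin] with τ hτ _
        have := mul_le_mul_of_nonneg_left ((hsort i j hij).2 h.symm) (le_of_lt hτ)
        linarith
    · exact Eventually.of_forall fun τ h => absurd h hij
  have hev1 : ∀ᶠ τ in 𝓝[>] (0:ℝ), τ ≤ 1 :=
    nhdsWithin_le_nhds (Iic_mem_nhds one_pos)
  rw [tendsto_iff_dist_tendsto_zero]
  refine squeeze_zero' (g := fun τ : ℝ => (C1 + C2) * τ)
    (Eventually.of_forall fun _ => dist_nonneg) ?_ ?_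
  · filter_upwards [hev, hev1, self_mem_nhdsWithin] with τ ha hb hc
    have hc : 0 < τ := hc
    have := key τ hc.le hb ha k
    rw [Real.dist_eq, hl]
    have e : (lamVec (X + τ • H) k - l k) / τ - m k =
        (lamVec (X + τ • H) k - (l k + τ * m k)) / τ := by
      field_simp; ring
    rw [e, abs_div, abs_of_pos hc, div_le_iff₀ hc]
    calc _ ≤ _ := this
      _ = _ := by ring
  · have : Continuous (fun τ : ℝ => (C1 + C2) * τ) := by fun_prop
    simpa using (this.tendsto 0).mono_left nhdsWithin_le_nhds

lemma perturb_frame {n : ℕ} (X H U : Matrix (Fin n) (Fin n) ℝ) (l m : Fin n → ℝ)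
    (hXs : X.IsSymm) (hH : H.IsSymm) (hU : Uᵀ * U = 1) (hX : Uᵀ * X * U = diagonal l)
    (hG : ∀ i j, l i = l j → (Uᵀ * H * U) i j = if i = j then m i else 0) :
    ∃ (e : Equiv.Perm (Fin n)) (U1 : Matrix (Fin n) (Fin n) ℝ),
      lamVec X = l ∘ e ∧ U1ᵀ * U1 = 1 ∧ U1ᵀ * X * U1 = diagonal (lamVec X) ∧
      (∀ i j, lamVec X i = lamVec X j → (U1ᵀ * H * U1) i j = if i = j then m (e i) else 0) ∧
      ∀ k, Tendsto (fun t : ℝ => (lamVec (X + t • H) k - lamVec X k) / t) (𝓝[>] 0)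
        (𝓝 (m (e k))) := by
  let f : Fin n → ℝ ×ₗ ℝ := fun i => toLex (-l i, -m i)
  let e := Tuple.sort f
  have hmono : Monotone (f ∘ e) := Tuple.monotone_sort f
  have hsub : ∀ A : Matrix (Fin n) (Fin n) ℝ, (U.submatrix id e)ᵀ * A * U.submatrix id e =
      (Uᵀ * A * U).submatrix e e := by
    intro A
    ext i j
    simp [Matrix.mul_apply]
  have hU1 : (U.submatrix id e)ᵀ * U.submatrix id e = 1 := by
    have := hsub 1
    simp only [Matrix.mul_one, hU] at this
    rw [this]; simp
  have hX1 : (U.submatrix id e)ᵀ * X * U.submatrix id e = diagonal (l ∘ e) := by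
    rw [hsub, hX, Matrix.submatrix_diagonal_equiv]
  have hG1 : ∀ i j, (l ∘ e) i = (l ∘ e) j → ((U.submatrix id e)ᵀ * H * U.submatrix id e) i j =
      if i = j then (m ∘ e) i else 0 := by
    intro i j hij
    rw [hsub, Matrix.submatrix_apply, hG _ _ hij]
    simp
  obtain ⟨r1, r2⟩ := perturb_sorted X H (U.submatrix id e) (l ∘ e) (m ∘ e) hXs hH hU1 hX1 hG1 (by
    intro i j hij
    have := hmono hij
    simp only [f, Function.comp, Prod.Lex.toLex_le_toLex', neg_le_neg_iff, neg_inj] at this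
    exact this)
  refine ⟨e, U.submatrix id e, r1, hU1, by rw [r1, hX1], ?_, r2⟩
  rw [r1]
  exact hG1

section phi

variable {n p : ℕ} [NeZero p] (a : Fin p → Fin n → ℝ) (c : Fin p → ℝ)

lemma le_pwa (x : Fin n → ℝ) (i : Fin p) : a i ⬝ᵥ x - c i ≤ pwa a c x :=
  le_ciSup (f := fun i => a i ⬝ᵥ x - c i) (Set.finite_range _).bddAbove i

lemma exists_pwa (x : Fin n → ℝ) : ∃ i, a i ⬝ᵥ x - c i = pwa a c x :=
  exists_eq_ciSup_of_finite (f := fun i => a i ⬝ᵥ x - c i)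

lemma act_nonempty (x : Fin n → ℝ) :
    (Finset.univ.filter (fun i => i ∈ iotaA a c x)).Nonempty := by
  obtain ⟨i, hi⟩ := exists_pwa a c x
  exact ⟨i, Finset.mem_filter.mpr ⟨Finset.mem_univ i, hi⟩⟩

/-- The directional derivative of `pwa a c` at `x` along `μ`. -/
def dphi (x μ : Fin n → ℝ) : ℝ :=
  (Finset.univ.filter (fun i => i ∈ iotaA a c x)).sup' (act_nonempty a c x) (fun i => a i ⬝ᵥ μ)

lemma le_dphi (x μ : Fin n → ℝ) (i : Fin p) (hi : i ∈ iotaA a c x) :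
    a i ⬝ᵥ μ ≤ dphi a c x μ :=
  Finset.le_sup' (fun i => a i ⬝ᵥ μ) (by simpa using hi)

lemma exists_dphi (x μ : Fin n → ℝ) : ∃ i ∈ iotaA a c x, dphi a c x μ = a i ⬝ᵥ μ := by
  obtain ⟨i, hi, h⟩ := Finset.exists_mem_eq_sup' (act_nonempty a c x) (fun i => a i ⬝ᵥ μ)
  exact ⟨i, by simpa using hi, h⟩

lemma pwa_deriv (x0 μ : Fin n → ℝ) (x : ℝ → Fin n → ℝ)
    (hx : ∀ k, Tendsto (fun t => (x t k - x0 k) / t) (𝓝[>] 0) (𝓝 (μ k))) :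
    Tendsto (fun t => (pwa a c (x t) - pwa a c x0) / t) (𝓝[>] 0) (𝓝 (dphi a c x0 μ)) := by
  have hpos : ∀ᶠ t in 𝓝[>] (0:ℝ), 0 < t := self_mem_nhdsWithin
  have hx0 : ∀ k, Tendsto (fun t => x t k) (𝓝[>] 0) (𝓝 (x0 k)) := by
    intro k
    have h1 : Tendsto (fun t : ℝ => t) (𝓝[>] 0) (𝓝 0) := tendsto_id.mono_left nhdsWithin_le_nhds
    have h2 := ((hx k).mul h1).add_const (x0 k)
    simp only [mul_zero, zero_add] at h2
    refine h2.congr' ?_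
    filter_upwards [hpos] with t ht
    field_simp
    ring
  have hf : ∀ i, Tendsto (fun t => a i ⬝ᵥ x t - c i) (𝓝[>] 0) (𝓝 (a i ⬝ᵥ x0 - c i)) := by
    intro i
    refine Tendsto.sub_const ?_ _
    exact tendsto_finsetSum _ fun k _ => (hx0 k).const_mul _
  have hd : ∀ i, Tendsto (fun t => (a i ⬝ᵥ x t - a i ⬝ᵥ x0) / t) (𝓝[>] 0) (𝓝 (a i ⬝ᵥ μ)) := by
    intro i
    have : Tendsto (fun t => ∑ k, a i k * ((x t k - x0 k) / t)) (𝓝[>] 0) (𝓝 (a i ⬝ᵥ μ)) :=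
      tendsto_finsetSum _ fun k _ => (hx k).const_mul _
    refine this.congr fun t => ?_
    simp only [dotProduct, ← Finset.sum_sub_distrib, Finset.sum_div]
    exact Finset.sum_congr rfl fun k _ => by ring
  obtain ⟨i0, hi0⟩ := exists_pwa a c x0
  have hin : ∀ᶠ t in 𝓝[>] (0:ℝ), ∀ i, i ∉ iotaA a c x0 →
      a i ⬝ᵥ x t - c i < a i0 ⬝ᵥ x t - c i0 := by
    rw [eventually_all]
    intro i
    by_cases hi : i ∈ iotaA a c x0
    · exact Eventually.of_forall fun t h => absurd hi h
    · have : a i ⬝ᵥ x0 - c i < a i0 ⬝ᵥ x0 - c i0 := by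
        rw [hi0]; exact lt_of_le_of_ne (le_pwa a c x0 i) hi
      filter_upwards [(hf i).eventually_lt (hf i0) this] with t ht _ using ht
  have hlim := Tendsto.finset_sup'_nhds_apply (act_nonempty a c x0) (fun i _ => hd i)
  refine hlim.congr' ?_
  filter_upwards [hpos, hin] with t ht hlt
  have hact : ∀ i ∈ iotaA a c x0,
      (a i ⬝ᵥ x t - a i ⬝ᵥ x0) / t = (a i ⬝ᵥ x t - c i - pwa a c x0) / t := by
    intro i hi
    have : a i ⬝ᵥ x0 - c i = pwa a c x0 := hi
    congr 1; linarith
  apply le_antisymm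
  · refine Finset.sup'_le _ _ fun i hi => ?_
    have hi : i ∈ iotaA a c x0 := by simpa using hi
    rw [hact i hi]
    have := le_pwa a c (x t) i
    gcongr
  · obtain ⟨i, hi⟩ := exists_pwa a c (x t)
    have hia : i ∈ iotaA a c x0 := by
      by_contra h
      have h1 := hlt i h
      have h2 := le_pwa a c (x t) i0
      linarith
    rw [← hi, ← hact i hia]
    exact Finset.le_sup' (fun i => (a i ⬝ᵥ x t - a i ⬝ᵥ x0) / t) (by simpa using hia)

lemma dphi_perm (hsym : ∀ (σ : Equiv.Perm (Fin n)) (x : Fin n → ℝ), pwa a c (x ∘ σ) = pwa a c x)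
    (x0 μ : Fin n → ℝ) (σ : Equiv.Perm (Fin n)) (hσ : x0 ∘ σ = x0) :
    dphi a c x0 (μ ∘ σ) = dphi a c x0 μ := by
  have lin : ∀ ν : Fin n → ℝ, Tendsto (fun t : ℝ => (pwa a c (x0 + t • ν) - pwa a c x0) / t)
      (𝓝[>] 0) (𝓝 (dphi a c x0 ν)) := by
    intro ν
    refine pwa_deriv a c x0 ν (fun t => x0 + t • ν) fun k => ?_
    refine tendsto_const_nhds.congr' ?_
    filter_upwards [self_mem_nhdsWithin] with t ht
    have : t ≠ 0 := ne_of_gt ht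
    simp [this]
  refine tendsto_nhds_unique (lin (μ ∘ σ)) ((lin μ).congr fun t => ?_)
  rw [← hsym σ (x0 + t • μ)]
  congr 3
  ext k
  have := congrFun hσ k
  simp only [Function.comp] at this
  simp [this]

end phi

lemma block_comp {n : ℕ} (H U U1 : Matrix (Fin n) (Fin n) ℝ) (X : Matrix (Fin n) (Fin n) ℝ)
    (l : Fin n → ℝ) (hU : Uᵀ * U = 1) (hXU : X = U * diagonal l * Uᵀ) (hU1 : U1ᵀ * U1 = 1)
    (hX1 : U1ᵀ * X * U1 = diagonal l) (i j : Fin n) (hij : l i = l j) (r : ℝ)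
    (hG : ∀ k k', l k = l i → l k' = l i → (U1ᵀ * H * U1) k k' = if k = k' then r else 0) :
    (Uᵀ * H * U) i j = if i = j then r else 0 := by
  have hU1' : U1 * U1ᵀ = 1 := mul_eq_one_comm.mp hU1
  set W := U1ᵀ * U with hW
  have hUW : U = U1 * W := by rw [hW, ← Matrix.mul_assoc, hU1', Matrix.one_mul]
  have hWW : Wᵀ * W = 1 := by
    rw [hW, Matrix.transpose_mul, Matrix.transpose_transpose, Matrix.mul_assoc,
      ← Matrix.mul_assoc U1, hU1', Matrix.one_mul, hU]
  have hcomm : diagonal l * W = W * diagonal l := by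
    have h1 : X * U = U * diagonal l := by
      rw [hXU, Matrix.mul_assoc _ Uᵀ U, hU, Matrix.mul_one]
    calc diagonal l * W = U1ᵀ * X * (U1 * W) := by rw [← hX1, Matrix.mul_assoc _ U1]
      _ = U1ᵀ * (X * U) := by rw [← hUW, Matrix.mul_assoc]
      _ = W * diagonal l := by rw [h1, ← Matrix.mul_assoc]
  have hW0 : ∀ k k', l k ≠ l k' → W k k' = 0 := by
    intro k k' h
    have := congrFun (congrFun hcomm k) k'
    rw [Matrix.diagonal_mul, Matrix.mul_diagonal] at this
    have h2 : (l k - l k') * W k k' = 0 := by linarith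
    exact (mul_eq_zero.mp h2).resolve_left (sub_ne_zero.mpr h)
  have hc : Uᵀ * H * U = Wᵀ * ((U1ᵀ * H * U1) * W) := by
    rw [hUW]; simp only [Matrix.transpose_mul, Matrix.mul_assoc]
  have hcol : ∀ k, l k = l i → ((U1ᵀ * H * U1) * W) k j = r * W k j := by
    intro k hk
    rw [Matrix.mul_apply, Finset.sum_eq_single k]
    · rw [hG k k hk hk, if_pos rfl]
    · intro k' _ hne
      by_cases h : l k' = l i
      · rw [hG k k' hk h, if_neg (Ne.symm hne), zero_mul]
      · rw [hW0 k' j (by rwa [← hij]), mul_zero]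
    · simp
  have hone : ∑ k, W k i * W k j = if i = j then 1 else 0 := by
    have := congrFun (congrFun hWW i) j
    rw [Matrix.mul_apply, Matrix.one_apply] at this
    simpa using this
  rw [hc, Matrix.mul_apply]
  have : ∀ k, Wᵀ i k * ((U1ᵀ * H * U1) * W) k j = r * (W k i * W k j) := by
    intro k
    rw [Matrix.transpose_apply]
    by_cases h : l k = l i
    · rw [hcol k h]; ring
    · rw [hW0 k i h]; ring
  rw [Finset.sum_congr rfl fun k _ => this k, ← Finset.mul_sum, hone]
  split_ifs <;> simp

lemma comp_swap {n : ℕ} (l : Fin n → ℝ) (x y : Fin n) (h : l x = l y) :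
    l ∘ (Equiv.swap x y) = l := by
  ext k
  simp only [Function.comp, Equiv.swap_apply_def]
  split_ifs with h1 h2
  · rw [h1, h]
  · rw [h2, h]
  · rfl

lemma const_on_block {n : ℕ} (l μ b : Fin n → ℝ) (r : ℝ)
    (h : ∀ σ : Equiv.Perm (Fin n), l ∘ σ = l → b ⬝ᵥ (μ ∘ σ) = r)
    (i j k k' : Fin n) (hj : l j = l i) (hk : l k = l i) (hk' : l k' = l i) (hb : b i ≠ b j) :
    μ k = μ k' := by
  by_contra hne
  have hkk : k ≠ k' := fun e => hne (by rw [e])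
  have hij : i ≠ j := fun e => hb (by rw [e])
  set j1 := Equiv.swap i k k' with hj1
  have hlj1 : l j1 = l i := by
    have := congrFun (comp_swap l i k hk.symm) k'
    simp only [Function.comp] at this
    rw [hj1, this, hk']
  have hj1i : j1 ≠ i := by
    intro e
    apply hkk
    have : Equiv.swap i k k' = Equiv.swap i k k := by rw [← hj1, e, Equiv.swap_apply_right]
    exact ((Equiv.swap i k).injective this).symm
  let σ : Equiv.Perm (Fin n) := Equiv.swap i k * Equiv.swap j j1
  have hσ : l ∘ σ = l := by
    have : l ∘ σ = (l ∘ Equiv.swap i k) ∘ Equiv.swap j j1 := rfl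
    rw [this, comp_swap l i k hk.symm, comp_swap l j j1 (by rw [hj, hlj1])]
  have hσi : σ i = k := by
    simp only [σ, Equiv.Perm.mul_apply]
    rw [Equiv.swap_apply_of_ne_of_ne hij (Ne.symm hj1i), Equiv.swap_apply_left]
  have hσj : σ j = k' := by
    simp only [σ, Equiv.Perm.mul_apply]
    rw [Equiv.swap_apply_left, hj1, Equiv.swap_apply_self]
  have hσ' : l ∘ (σ * Equiv.swap i j : Equiv.Perm (Fin n)) = l := by
    have : l ∘ (σ * Equiv.swap i j : Equiv.Perm (Fin n)) = (l ∘ σ) ∘ Equiv.swap i j := rfl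
    rw [this, hσ, comp_swap l i j hj.symm]
  have e1 := h σ hσ
  have e2 := h _ hσ'
  have hdiff : b ⬝ᵥ (μ ∘ σ) - b ⬝ᵥ (μ ∘ (σ * Equiv.swap i j : Equiv.Perm (Fin n))) =
      (b i - b j) * (μ k - μ k') := by
    simp only [dotProduct, ← Finset.sum_sub_distrib, Function.comp, Equiv.Perm.mul_apply]
    rw [← Finset.sum_subset (Finset.subset_univ {i, j}), Finset.sum_pair hij,
      Equiv.swap_apply_left, Equiv.swap_apply_right, hσi, hσj]
    · ring
    · intro x _ hx
      simp only [Finset.mem_insert, Finset.mem_singleton, not_or] at hx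
      rw [Equiv.swap_apply_of_ne_of_ne hx.1 hx.2]; ring
  rw [e1, e2, sub_self] at hdiff
  rcases mul_eq_zero.mp hdiff.symm with h0 | h0
  · exact hb (sub_eq_zero.mp h0)
  · exact hne (sub_eq_zero.mp h0)

/-- Proposition 3.1.  Characterization of the lineality space
`T^lin_{θ₁}(X̄) = {H ∈ Sⁿ : θ₁'(X̄;H) = -θ₁'(X̄;-H)}` of the spectral function `θ₁ = φ₁ ∘ λ`:
membership is equivalent to `⟨λ'(X̄;H), aⁱ - aʲ⟩ = 0` for all active `i, j`, and it forces
`Ūᵀ_{αˡ} H Ū_{αˡ} = ρ̂ₗ I` on every "bad" eigenvalue block, for every `Ū ∈ 𝕆ⁿ(X̄)`. -/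
theorem stmt4 {n p : ℕ} [NeZero p]
    (a : Fin p → Fin n → ℝ) (c : Fin p → ℝ)
    (hsym : ∀ (σ : Equiv.Perm (Fin n)) (x : Fin n → ℝ), pwa a c (x ∘ σ) = pwa a c x)
    (theta1 : Matrix (Fin n) (Fin n) ℝ → ℝ)
    (htheta1 : theta1 = fun X => pwa a c (lamVec X))
    (Xb : Matrix (Fin n) (Fin n) ℝ) (hXb : Xb.IsSymm)
    (H : Matrix (Fin n) (Fin n) ℝ) (hH : H.IsSymm) :
    (dirDeriv theta1 Xb H = -dirDeriv theta1 Xb (-H) ↔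
      ∀ i ∈ iotaA a c (lamVec Xb), ∀ j ∈ iotaA a c (lamVec Xb),
        lamDD Xb H ⬝ᵥ (a i - a j) = 0) ∧
    (dirDeriv theta1 Xb H = -dirDeriv theta1 Xb (-H) →
      ∃ ρ : Fin n → ℝ, (∀ i j : Fin n, lamVec Xb i = lamVec Xb j → ρ i = ρ j) ∧
        ∀ U ∈ OSet Xb, ∀ i j : Fin n, lamVec Xb i = lamVec Xb j →
          (∃ i' j' : Fin n, lamVec Xb i' = lamVec Xb i ∧ lamVec Xb j' = lamVec Xb i ∧
            ∃ w ∈ iotaA a c (lamVec Xb), a w i' ≠ a w j') →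
          (Uᵀ * H * U) i j = if i = j then ρ i else 0) := by
  obtain ⟨U0, l0, m0, hU0, hX0, hG0⟩ := exists_frame Xb H hXb hH
  obtain ⟨e0, U1, -, hU1, hX1, hG1, hlim⟩ := perturb_frame Xb H U0 l0 m0 hXb hH hU0 hX0 hG0
  set lam := lamVec Xb with hlam
  set μ : Fin n → ℝ := m0 ∘ e0 with hμ
  have hG1' : ∀ i j, lam i = lam j → (U1ᵀ * (-H) * U1) i j = if i = j then (-μ) i else 0 := by
    intro i j hij
    rw [Matrix.mul_neg, Matrix.neg_mul, Matrix.neg_apply, hG1 i j hij]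
    split_ifs <;> simp [hμ]
  obtain ⟨e1, -, hl1, -, -, -, hlim1⟩ :=
    perturb_frame Xb (-H) U1 lam (-μ) hXb hH.neg hU1 hX1 hG1'
  have hDD : lamDD Xb H = μ := by
    ext k
    exact (hlim k).limUnder_eq
  have hd1 : dirDeriv theta1 Xb H = dphi a c lam μ := by
    rw [htheta1]
    exact (pwa_deriv a c lam μ (fun t => lamVec (Xb + t • H)) hlim).limUnder_eq
  have hd2 : dirDeriv theta1 Xb (-H) = dphi a c lam (-μ) := by
    rw [htheta1, ← dphi_perm a c hsym lam (-μ) e1 hl1.symm]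
    exact (pwa_deriv a c lam ((-μ) ∘ e1) (fun t => lamVec (Xb + t • (-H))) hlim1).limUnder_eq
  rw [hd1, hd2, hDD]
  have hall : dphi a c lam μ = -dphi a c lam (-μ) → ∀ σ : Equiv.Perm (Fin n), lam ∘ σ = lam →
      ∀ w ∈ iotaA a c lam, a w ⬝ᵥ (μ ∘ σ) = dphi a c lam μ := by
    intro h σ hσ w hw
    have h1 := le_dphi a c lam (μ ∘ σ) w hw
    have h2 := le_dphi a c lam ((-μ) ∘ σ) w hw
    rw [dphi_perm a c hsym lam _ σ hσ] at h1 h2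
    have h3 : a w ⬝ᵥ ((-μ) ∘ σ) = - (a w ⬝ᵥ (μ ∘ σ)) := by
      rw [← dotProduct_neg]; rfl
    linarith
  refine ⟨⟨?_, ?_⟩, ?_⟩
  · intro h i hi j hj
    have h1 := hall h 1 rfl i hi
    have h2 := hall h 1 rfl j hj
    have h3 : μ ∘ (1 : Equiv.Perm (Fin n)) = μ := rfl
    rw [h3] at h1 h2
    rw [dotProduct_sub, dotProduct_comm, dotProduct_comm μ, h1, h2, sub_self]
  · intro h
    obtain ⟨i, hi, hi'⟩ := exists_dphi a c lam μ
    obtain ⟨j, hj, hj'⟩ := exists_dphi a c lam (-μ)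
    have := h i hi j hj
    rw [dotProduct_sub, dotProduct_comm, dotProduct_comm μ] at this
    rw [hi', hj', dotProduct_neg]
    linarith
  · intro h
    let bad : ℝ → Prop := fun v => ∃ i' j' : Fin n, lam i' = v ∧ lam j' = v ∧
      ∃ w ∈ iotaA a c lam, a w i' ≠ a w j'
    have hconst : ∀ i j, lam i = lam j → bad (lam i) → μ i = μ j := by
      rintro i j hij ⟨i', j', hi', hj', w, hw, hne⟩
      exact const_on_block lam μ (a w) (dphi a c lam μ) (fun σ hσ => hall h σ hσ w hw) i' j' i j
        (by rw [hi', hj']) hi'.symm (by rw [hi', hij]) hne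
    refine ⟨fun i => if bad (lam i) then μ i else 0, ?_, ?_⟩
    · intro i j hij
      by_cases hb : bad (lam i)
      · have hb' : bad (lam j) := hij ▸ hb
        simp only [if_pos hb, if_pos hb']
        exact hconst i j hij hb
      · have hb' : ¬ bad (lam j) := hij ▸ hb
        simp only [if_neg hb, if_neg hb']
    · intro U hU i j hij hb
      have hb : bad (lam i) := hb
      simp only [if_pos hb]
      refine block_comp H U U1 Xb lam hU.1 hU.2 hU1 hX1 i j hij (μ i) ?_
      intro k k' hk hk'
      rw [hG1 k k' (hk.trans hk'.symm)]
      have : μ i = m0 (e0 k) := hconst i k hk.symm hb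
      rw [this]

end
end

section
/- Let θ1 = φ1∘λ with φ1 symmetric convex piecewise affine, (X̄,Ȳ) ∈ gph ∂θ1, and Ū ∈ 𝕆ⁿ(X̄) ∩ 𝕆ⁿ(Ȳ). Then H belongs to the affine hull of the critical cone C(X̄+Ȳ; ∂θ1(X̄)) if and only if the following three conditions hold: (i) for each l, Ūᵀ_{α^l} H Ū_{α^l} is block diagonal with respect to the partition {β^l_k}_{k=1}^{s_l}; (ii) for each l and each k ∈ E^l there exists a scalar ρ^l_k with (Ūᵀ_{α^l} H Ū_{α^l})_{β^l_k β^l_k} = ρ^l_k I_{|β^l_k|}; (iii) ⟨diag(Ūᵀ H Ū), aⁱ − aʲ⟩ = 0 for all i,j ∈ η1(λ(X̄),λ(Ȳ)). -/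
open Matrix Filter Topology Set
open scoped Classical

noncomputable section

/-- The index set `η₁(x̄,ȳ)`: active indices carrying a strictly positive weight in some
convex-combination representation of `ȳ` by the active `aⁱ`'s. -/
def etaA {n p : ℕ} [NeZero p] (a : Fin p → Fin n → ℝ) (c : Fin p → ℝ)
    (x y : Fin n → ℝ) : Set (Fin p) :=
  {i | ∃ u : Fin p → ℝ, (∀ j, 0 ≤ u j) ∧ (∀ j, j ∉ iotaA a c x → u j = 0) ∧
        (∑ j, u j) = 1 ∧ y = ∑ j, u j • a j ∧ 0 < u i}

/-- `i` and `j` belong to the same block `αˡ` of `X̄`. -/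
def sameA {n : ℕ} (X : Matrix (Fin n) (Fin n) ℝ) (i j : Fin n) : Prop :=
  lamVec X i = lamVec X j

/-- `i` and `j` belong to the same sub-block `βˡₖ` (determined by the eigenvalues of both `X̄`
and `Ȳ`). -/
def sameB {n : ℕ} (X Y : Matrix (Fin n) (Fin n) ℝ) (i j : Fin n) : Prop :=
  lamVec X i = lamVec X j ∧ lamVec Y i = lamVec Y j

/-- The sub-block `βˡₖ` containing `i` is a "bad" block, i.e. `k ∈ Eˡ`: some `a^w`,
`w ∈ η₁(λ(X̄),λ(Ȳ))`, is non-constant on it. -/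
def badB {n p : ℕ} [NeZero p] (a : Fin p → Fin n → ℝ) (c : Fin p → ℝ)
    (X Y : Matrix (Fin n) (Fin n) ℝ) (i : Fin n) : Prop :=
  ∃ z z' : Fin n, sameB X Y z i ∧ sameB X Y z' i ∧
    ∃ w ∈ etaA a c (lamVec X) (lamVec Y), a w z ≠ a w z'

/-- The critical cone `C(X̄+Ȳ; ∂θ₁(X̄)) := {H ∈ Sⁿ : θ₁'(X̄;H) = ⟨Ȳ,H⟩}`. -/
def critM1 {n : ℕ} (theta1 : Matrix (Fin n) (Fin n) ℝ → ℝ)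
    (Xb Yb : Matrix (Fin n) (Fin n) ℝ) : Set (Matrix (Fin n) (Fin n) ℝ) :=
  {H | H.IsSymm ∧ dirDeriv theta1 Xb H = mip Yb H}


namespace S6

variable {n p : ℕ}

lemma pwa_ge [NeZero p] (a : Fin p → Fin n → ℝ) (c : Fin p → ℝ) (x : Fin n → ℝ) (i : Fin p) :
    a i ⬝ᵥ x - c i ≤ pwa a c x :=
  le_ciSup (f := fun i => a i ⬝ᵥ x - c i) (Set.finite_range _).bddAbove i

lemma pwa_att [NeZero p] (a : Fin p → Fin n → ℝ) (c : Fin p → ℝ) (x : Fin n → ℝ) :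
    ∃ i, a i ⬝ᵥ x - c i = pwa a c x :=
  exists_eq_ciSup_of_finite (f := fun i => a i ⬝ᵥ x - c i)

/-- Orthogonal matrices squared entrywise are doubly stochastic. -/
lemma pwa_schur [NeZero p] (a : Fin p → Fin n → ℝ) (c : Fin p → ℝ)
    (hsym : ∀ (σ : Equiv.Perm (Fin n)) (x : Fin n → ℝ), pwa a c (x ∘ σ) = pwa a c x)
    (W : Matrix (Fin n) (Fin n) ℝ) (hW : Wᵀ * W = 1) (y : Fin n → ℝ) :
    pwa a c (fun k => (Wᵀ * diagonal y * W) k k) ≤ pwa a c y := by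
  have hW' : W * Wᵀ = 1 := mul_eq_one_comm.mp hW
  let M : Matrix (Fin n) (Fin n) ℝ := fun k l => W l k ^ 2
  have hM : M ∈ doublyStochastic ℝ (Fin n) := by
    rw [mem_doublyStochastic_iff_sum]
    refine ⟨fun i j => sq_nonneg _, fun i => ?_, fun j => ?_⟩
    · have := congrFun (congrFun hW i) i
      simp only [mul_apply, transpose_apply, one_apply_eq] at this
      simp only [M, sq, this]
    · have := congrFun (congrFun hW' j) j
      simp only [mul_apply, transpose_apply, one_apply_eq] at this
      simp only [M, sq, this]
  obtain ⟨w, hw0, hw1, hw2⟩ := exists_eq_sum_perm_of_mem_doublyStochastic hM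
  have hd : (fun k => (Wᵀ * diagonal y * W) k k) = ∑ σ, w σ • (y ∘ σ) := by
    have h1 : (fun k => (Wᵀ * diagonal y * W) k k) = M *ᵥ y := by
      ext k
      rw [mul_apply]
      simp only [mul_diagonal, transpose_apply, mulVec, dotProduct, M]
      exact Finset.sum_congr rfl fun l _ => by ring
    rw [h1, ← hw2]
    ext k
    rw [Matrix.sum_mulVec]
    simp [Finset.sum_apply, Matrix.smul_mulVec, Matrix.permMatrix_mulVec]
  rw [hd]
  obtain ⟨i, hi⟩ := pwa_att a c (∑ σ, w σ • (y ∘ σ))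
  rw [← hi, dotProduct_sum]
  have : c i = ∑ σ, w σ * c i := by rw [← Finset.sum_mul, hw1, one_mul]
  rw [this, ← Finset.sum_sub_distrib]
  calc ∑ σ, (a i ⬝ᵥ w σ • (y ∘ σ) - w σ * c i) ≤ ∑ σ, w σ * pwa a c y := by
        refine Finset.sum_le_sum fun σ _ => ?_
        rw [dotProduct_smul, smul_eq_mul, ← mul_sub, ← hsym σ y]
        exact mul_le_mul_of_nonneg_left (pwa_ge a c _ i) (hw0 σ)
    _ = pwa a c y := by rw [← Finset.sum_mul, hw1, one_mul]

/-- Spectral theorem with the ordered vector of eigenvalues. -/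
lemma exists_orth (X : Matrix (Fin n) (Fin n) ℝ) (hX : X.IsSymm) :
    ∃ V : Matrix (Fin n) (Fin n) ℝ, Vᵀ * V = 1 ∧ X = V * diagonal (lamVec X) * Vᵀ := by
  have h : X.IsHermitian := by
    rw [Matrix.IsHermitian, conjTranspose_eq_transpose_of_trivial]; exact hX
  let τ : Equiv.Perm (Fin n) := Fin.revPerm.trans (Tuple.sort h.eigenvalues)
  have hl : lamVec X = h.eigenvalues ∘ τ := by
    funext i
    rw [lamVec, dif_pos h]
    rfl
  let V0 : Matrix (Fin n) (Fin n) ℝ := h.eigenvectorUnitary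
  have hV0 : V0ᵀ * V0 = 1 := by
    have := (Matrix.mem_unitaryGroup_iff').mp h.eigenvectorUnitary.2
    rwa [star_eq_conjTranspose, conjTranspose_eq_transpose_of_trivial] at this
  have hsp : X = V0 * diagonal h.eigenvalues * V0ᵀ := by
    have := h.spectral_theorem
    rw [Unitary.conjStarAlgAut_apply] at this
    conv_lhs => rw [this]
    rfl
  refine ⟨V0.submatrix id τ, ?_, ?_⟩
  · rw [transpose_submatrix, ← Matrix.submatrix_mul V0ᵀ V0 τ id τ Function.bijective_id, hV0,
      submatrix_one_equiv]
  · rw [hl, ← submatrix_diagonal_equiv, transpose_submatrix,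
      ← Matrix.submatrix_mul _ _ _ _ _ τ.bijective, ← Matrix.submatrix_mul _ _ _ _ _ τ.bijective,
      ← hsp, submatrix_id_id]

/-- The diagonal of `Uᵀ X U`. -/
def dg (U X : Matrix (Fin n) (Fin n) ℝ) : Fin n → ℝ := fun k => (Uᵀ * X * U) k k

lemma dg_add (U X Y : Matrix (Fin n) (Fin n) ℝ) : dg U (X + Y) = dg U X + dg U Y := by
  ext k; simp [dg, Matrix.mul_add, Matrix.add_mul]

lemma dg_smul (U X : Matrix (Fin n) (Fin n) ℝ) (t : ℝ) : dg U (t • X) = t • dg U X := by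
  ext k; simp [dg]

lemma dg_conj (U V : Matrix (Fin n) (Fin n) ℝ) (x : Fin n → ℝ) :
    dg U (V * diagonal x * Vᵀ) = dg (Vᵀ * U) (diagonal x) := by
  unfold dg
  simp only [transpose_mul, transpose_transpose, Matrix.mul_assoc]

lemma dg_self (U : Matrix (Fin n) (Fin n) ℝ) (hU : Uᵀ * U = 1) (x : Fin n → ℝ) :
    dg U (U * diagonal x * Uᵀ) = x := by
  rw [dg_conj, hU]; ext k; simp [dg]

lemma orth_mul (U V : Matrix (Fin n) (Fin n) ℝ) (hU : Uᵀ * U = 1) (hV : Vᵀ * V = 1) :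
    (Vᵀ * U)ᵀ * (Vᵀ * U) = 1 := by
  have hV' : V * Vᵀ = 1 := mul_eq_one_comm.mp hV
  rw [transpose_mul, transpose_transpose, Matrix.mul_assoc, ← Matrix.mul_assoc V, hV',
    Matrix.one_mul, hU]

lemma symm_conj (U : Matrix (Fin n) (Fin n) ℝ) (X : Matrix (Fin n) (Fin n) ℝ) (hX : X.IsSymm) :
    (U * X * Uᵀ).IsSymm := by
  unfold Matrix.IsSymm
  rw [transpose_mul, transpose_mul, transpose_transpose, hX.eq, Matrix.mul_assoc]

section

lemma th_ge [NeZero p] (a : Fin p → Fin n → ℝ) (c : Fin p → ℝ)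
    (hsym : ∀ (σ : Equiv.Perm (Fin n)) (x : Fin n → ℝ), pwa a c (x ∘ σ) = pwa a c x)
    (X : Matrix (Fin n) (Fin n) ℝ) (hX : X.IsSymm) (U : Matrix (Fin n) (Fin n) ℝ)
    (hU : Uᵀ * U = 1) : pwa a c (dg U X) ≤ pwa a c (lamVec X) := by
  obtain ⟨V, hV, h⟩ := exists_orth X hX
  have : dg U X = dg (Vᵀ * U) (diagonal (lamVec X)) := by rw [← dg_conj, ← h]
  rw [this]
  exact pwa_schur a c hsym _ (orth_mul U V hU hV) _

lemma th_ge_i [NeZero p] (a : Fin p → Fin n → ℝ) (c : Fin p → ℝ)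
    (hsym : ∀ (σ : Equiv.Perm (Fin n)) (x : Fin n → ℝ), pwa a c (x ∘ σ) = pwa a c x)
    (X : Matrix (Fin n) (Fin n) ℝ) (hX : X.IsSymm) (U : Matrix (Fin n) (Fin n) ℝ)
    (hU : Uᵀ * U = 1) (i : Fin p) : a i ⬝ᵥ dg U X - c i ≤ pwa a c (lamVec X) :=
  (pwa_ge a c _ i).trans (th_ge a c hsym X hX U hU)

lemma th_eq [NeZero p] (a : Fin p → Fin n → ℝ) (c : Fin p → ℝ)
    (hsym : ∀ (σ : Equiv.Perm (Fin n)) (x : Fin n → ℝ), pwa a c (x ∘ σ) = pwa a c x)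
    (U : Matrix (Fin n) (Fin n) ℝ) (hU : Uᵀ * U = 1) (x : Fin n → ℝ) :
    pwa a c (lamVec (U * diagonal x * Uᵀ)) = pwa a c x := by
  have hX : (U * diagonal x * Uᵀ).IsSymm := symm_conj _ _ (isSymm_diagonal x)
  apply le_antisymm
  · obtain ⟨V, hV, h⟩ := exists_orth _ hX
    have : lamVec (U * diagonal x * Uᵀ) = dg (Uᵀ * V) (diagonal x) := by
      rw [← dg_conj]
      conv_rhs => rw [h]
      rw [dg_self V hV]
    rw [this]
    exact pwa_schur a c hsym _ (orth_mul V U hV hU) _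
  · have := th_ge a c hsym _ hX U hU
    rwa [dg_self U hU] at this

lemma th_att [NeZero p] (a : Fin p → Fin n → ℝ) (c : Fin p → ℝ)
    (X : Matrix (Fin n) (Fin n) ℝ) (hX : X.IsSymm) :
    ∃ (V : Matrix (Fin n) (Fin n) ℝ) (i : Fin p), Vᵀ * V = 1 ∧
      a i ⬝ᵥ dg V X - c i = pwa a c (lamVec X) := by
  obtain ⟨V, hV, h⟩ := exists_orth X hX
  obtain ⟨i, hi⟩ := pwa_att a c (lamVec X)
  refine ⟨V, i, hV, ?_⟩
  rw [← hi]
  conv_lhs => rw [h]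
  rw [dg_self V hV]

lemma th_conv [NeZero p] (a : Fin p → Fin n → ℝ) (c : Fin p → ℝ)
    (hsym : ∀ (σ : Equiv.Perm (Fin n)) (x : Fin n → ℝ), pwa a c (x ∘ σ) = pwa a c x)
    (X H : Matrix (Fin n) (Fin n) ℝ) (hX : X.IsSymm) (hH : H.IsSymm) :
    ConvexOn ℝ univ (fun t : ℝ => pwa a c (lamVec (X + t • H))) := by
  refine ⟨convex_univ, ?_⟩
  intro s _ t _ u v hu hv huv
  have hs : ∀ r : ℝ, (X + r • H).IsSymm := fun r => hX.add (hH.smul r)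
  obtain ⟨V, i, hV, h⟩ := th_att a c (X + (u • s + v • t) • H) (hs _)
  have h1 := th_ge_i a c hsym _ (hs s) V hV i
  have h2 := th_ge_i a c hsym _ (hs t) V hV i
  simp only [smul_eq_mul] at h ⊢
  rw [← h]
  rw [dg_add, dg_smul, dotProduct_add, dotProduct_smul, smul_eq_mul] at *
  have e1 := mul_le_mul_of_nonneg_left h1 hu
  have e2 := mul_le_mul_of_nonneg_left h2 hv
  have : v = 1 - u := by linarith
  subst this
  linarith

lemma th_lim [NeZero p] (a : Fin p → Fin n → ℝ) (c : Fin p → ℝ)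
    (hsym : ∀ (σ : Equiv.Perm (Fin n)) (x : Fin n → ℝ), pwa a c (x ∘ σ) = pwa a c x)
    (X H : Matrix (Fin n) (Fin n) ℝ) (hX : X.IsSymm) (hH : H.IsSymm) :
    Tendsto (fun t : ℝ => (pwa a c (lamVec (X + t • H)) - pwa a c (lamVec X)) / t) (𝓝[>] (0:ℝ))
      (𝓝 (dirDeriv (fun X => pwa a c (lamVec X)) X H)) := by
  have h := (th_conv a c hsym X H hX hH).hasDerivWithinAt_rightDeriv_of_mem_interior
    (x := 0) (by simp)
  rw [hasDerivWithinAt_iff_tendsto_slope' (by simp)] at h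
  have h' : Tendsto (fun t : ℝ => (pwa a c (lamVec (X + t • H)) - pwa a c (lamVec X)) / t)
      (𝓝[>] (0:ℝ)) (𝓝 (derivWithin (fun t : ℝ => pwa a c (lamVec (X + t • H))) (Ioi 0) 0)) := by
    refine h.congr fun t => ?_
    simp [slope_def_field]
  unfold dirDeriv
  rw [h'.limUnder_eq]
  exact h'

lemma dd_ge [NeZero p] (a : Fin p → Fin n → ℝ) (c : Fin p → ℝ)
    (hsym : ∀ (σ : Equiv.Perm (Fin n)) (x : Fin n → ℝ), pwa a c (x ∘ σ) = pwa a c x)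
    (X H : Matrix (Fin n) (Fin n) ℝ) (hX : X.IsSymm) (hH : H.IsSymm)
    (U : Matrix (Fin n) (Fin n) ℝ) (hU : Uᵀ * U = 1) (hUX : X = U * diagonal (lamVec X) * Uᵀ)
    (i : Fin p) (hi : i ∈ iotaA a c (lamVec X)) :
    a i ⬝ᵥ dg U H ≤ dirDeriv (fun X => pwa a c (lamVec X)) X H := by
  refine ge_of_tendsto (th_lim a c hsym X H hX hH) ?_
  filter_upwards [self_mem_nhdsWithin] with t ht
  have ht : 0 < t := ht
  rw [le_div_iff₀ ht]
  have h1 := th_ge_i a c hsym (X + t • H) (hX.add (hH.smul t)) U hU i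
  have h2 : a i ⬝ᵥ lamVec X - c i = pwa a c (lamVec X) := hi
  have h3 : dg U X = lamVec X := by
    conv_lhs => rw [hUX]
    rw [dg_self U hU]
  rw [dg_add, dg_smul, dotProduct_add, dotProduct_smul, smul_eq_mul, h3] at h1
  linarith

lemma dd_eq_of [NeZero p] (a : Fin p → Fin n → ℝ) (c : Fin p → ℝ)
    (X H : Matrix (Fin n) (Fin n) ℝ) (d : ℝ)
    (h : Tendsto (fun t : ℝ => (pwa a c (lamVec (X + t • H)) - pwa a c (lamVec X)) / t)
      (𝓝[>] (0:ℝ)) (𝓝 d)) : dirDeriv (fun X => pwa a c (lamVec X)) X H = d :=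
  h.limUnder_eq

lemma orth_entry (V : Matrix (Fin n) (Fin n) ℝ) (hV : Vᵀ * V = 1) (l k : Fin n) : |V l k| ≤ 1 := by
  have := congrFun (congrFun hV k) k
  simp only [mul_apply, transpose_apply, one_apply_eq] at this
  rw [abs_le_one_iff_mul_self_le_one, ← this]
  exact Finset.single_le_sum (f := fun l => V l k * V l k)
    (fun i _ => mul_self_nonneg _) (Finset.mem_univ l)

/-- Lipschitz estimate. -/
lemma th_lip [NeZero p] (a : Fin p → Fin n → ℝ) (c : Fin p → ℝ)
    (hsym : ∀ (σ : Equiv.Perm (Fin n)) (x : Fin n → ℝ), pwa a c (x ∘ σ) = pwa a c x)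
    (X Y : Matrix (Fin n) (Fin n) ℝ) (hX : X.IsSymm) (hY : Y.IsSymm) :
    pwa a c (lamVec X) ≤ pwa a c (lamVec Y) +
      (∑ i, ∑ k, |a i k|) * ∑ l, ∑ m, |X l m - Y l m| := by
  obtain ⟨V, i, hV, h⟩ := th_att a c X hX
  have h1 := th_ge_i a c hsym Y hY V hV i
  have h2 : dg V X = dg V Y + dg V (X - Y) := by rw [← dg_add]; congr 1; abel
  rw [← h, h2, dotProduct_add]
  have h3 : ∀ k, |dg V (X - Y) k| ≤ ∑ l, ∑ m, |X l m - Y l m| := by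
    intro k
    have : dg V (X - Y) k = ∑ m, ∑ l, V l k * (X l m - Y l m) * V m k := by
      simp only [dg, mul_apply, transpose_apply, Finset.sum_mul, Matrix.sub_apply]
    rw [this, Finset.sum_comm]
    refine (Finset.abs_sum_le_sum_abs _ _).trans (Finset.sum_le_sum fun l _ => ?_)
    refine (Finset.abs_sum_le_sum_abs _ _).trans (Finset.sum_le_sum fun m _ => ?_)
    rw [abs_mul, abs_mul]
    have := orth_entry V hV l k
    have := orth_entry V hV m k
    calc |V l k| * |X l m - Y l m| * |V m k| ≤ 1 * |X l m - Y l m| * 1 := by gcongr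
      _ = _ := by ring
  have h4 : a i ⬝ᵥ dg V (X - Y) ≤ (∑ i, ∑ k, |a i k|) * ∑ l, ∑ m, |X l m - Y l m| := by
    have h5 : ∑ k, |a i k| ≤ ∑ i, ∑ k, |a i k| :=
      Finset.single_le_sum (f := fun i => ∑ k, |a i k|)
        (fun i _ => Finset.sum_nonneg fun _ _ => abs_nonneg _) (Finset.mem_univ i)
    have h6 : 0 ≤ ∑ l, ∑ m, |X l m - Y l m| :=
      Finset.sum_nonneg fun _ _ => Finset.sum_nonneg fun _ _ => abs_nonneg _
    refine le_trans ?_ (mul_le_mul_of_nonneg_right h5 h6)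
    rw [Finset.sum_mul]
    refine Finset.sum_le_sum fun k _ => ?_
    refine (le_abs_self _).trans ?_
    rw [abs_mul]
    exact mul_le_mul_of_nonneg_left (h3 k) (abs_nonneg _)
  linarith

end

end S6

namespace S6

variable {n p : ℕ}

lemma exp_skew_orth (S : Matrix (Fin n) (Fin n) ℝ) (hS : Sᵀ = -S) :
    (NormedSpace.exp S)ᵀ * NormedSpace.exp S = 1 := by
  rw [← Matrix.exp_transpose, hS, Matrix.exp_neg]
  exact Matrix.nonsing_inv_mul _ ((Matrix.isUnit_iff_isUnit_det _).mp (Matrix.isUnit_exp S))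

open scoped Matrix.Norms.Operator in
lemma curve_deriv (S L D U : Matrix (Fin n) (Fin n) ℝ) :
    HasDerivAt (fun s : ℝ => U * (NormedSpace.exp (s • S) * (L + s • D) *
      NormedSpace.exp (s • (-S))) * Uᵀ) (U * (D + (S * L - L * S)) * Uᵀ) 0 := by
  have h1 := hasDerivAt_exp_smul_const (𝕂 := ℝ) S 0
  have h2 := hasDerivAt_exp_smul_const (𝕂 := ℝ) (-S) 0
  have h3 : HasDerivAt (fun s : ℝ => L + s • D) D 0 := by
    have := ((hasDerivAt_id (0:ℝ)).smul_const D).const_add L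
    rw [one_smul] at this
    exact this
  have h4 := (((h1.mul h3).mul h2).const_mul U).mul_const Uᵀ
  simp only [Pi.mul_apply] at h4
  have h5 : U * (D + (S * L - L * S)) * Uᵀ = U * ((NormedSpace.exp ((0:ℝ) • S) * S * (L + (0:ℝ) • D)
      + NormedSpace.exp ((0:ℝ) • S) * D) * NormedSpace.exp ((0:ℝ) • -S) +
        NormedSpace.exp ((0:ℝ) • S) * (L + (0:ℝ) • D) * (NormedSpace.exp ((0:ℝ) • -S) * -S)) * Uᵀ := by
    simp only [zero_smul, NormedSpace.exp_zero, add_zero]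
    noncomm_ring
  rw [h5]
  exact h4

open scoped Matrix.Norms.Operator in
lemma curve_tendsto (S L D U : Matrix (Fin n) (Fin n) ℝ) (l m : Fin n) :
    Tendsto (fun s : ℝ => ((U * (NormedSpace.exp (s • S) * (L + s • D) *
      NormedSpace.exp (s • (-S))) * Uᵀ) l m - (U * L * Uᵀ) l m) / s) (𝓝[>] (0:ℝ))
      (𝓝 ((U * (D + (S * L - L * S)) * Uᵀ) l m)) := by
  have h := (hasDerivAt_iff_tendsto_slope.mp (curve_deriv S L D U))
  have h' := h.mono_left (nhdsWithin_mono (0:ℝ) (s := Ioi 0) (fun x hx => ne_of_gt hx))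
  have h2 := (tendsto_pi_nhds.mp ((tendsto_pi_nhds.mp h') l)) m
  refine h2.congr fun s => ?_
  simp only [slope, vsub_eq_sub, sub_zero]
  rw [Matrix.smul_apply, Matrix.sub_apply]
  simp [div_eq_inv_mul]

section

lemma pwa_small [NeZero p] (a : Fin p → Fin n → ℝ) (c : Fin p → ℝ)
    (x e : Fin n → ℝ) (m : ℝ) (hm : ∀ i ∈ iotaA a c x, a i ⬝ᵥ e ≤ m) :
    ∀ᶠ s in 𝓝[>] (0:ℝ), pwa a c (x + s • e) ≤ pwa a c x + s * m := by
  have key : ∀ i, ∀ᶠ s in 𝓝[>] (0:ℝ), a i ⬝ᵥ (x + s • e) - c i ≤ pwa a c x + s * m := by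
    intro i
    by_cases hi : i ∈ iotaA a c x
    · filter_upwards [self_mem_nhdsWithin] with s hs
      have hs : 0 < s := hs
      have h1 : a i ⬝ᵥ x - c i = pwa a c x := hi
      rw [dotProduct_add, dotProduct_smul, smul_eq_mul]
      have := mul_le_mul_of_nonneg_left (hm i hi) hs.le
      linarith
    · have h1 : a i ⬝ᵥ x - c i < pwa a c x := lt_of_le_of_ne (pwa_ge a c x i) hi
      have hc : Continuous fun s : ℝ => (pwa a c x + s * m) - (a i ⬝ᵥ x + s * (a i ⬝ᵥ e) - c i) := by
        fun_prop
      have h2 : ∀ᶠ s in 𝓝 (0:ℝ), 0 < (pwa a c x + s * m) - (a i ⬝ᵥ x + s * (a i ⬝ᵥ e) - c i) := by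
        apply hc.continuousAt.eventually_const_lt
        simp; linarith
      filter_upwards [h2.filter_mono nhdsWithin_le_nhds] with s hs
      rw [dotProduct_add, dotProduct_smul, smul_eq_mul]
      linarith
  filter_upwards [eventually_all.mpr key] with s hs
  obtain ⟨i, hi⟩ := pwa_att a c (x + s • e)
  rw [← hi]; exact hs i

lemma crit_dd [NeZero p] (a : Fin p → Fin n → ℝ) (c : Fin p → ℝ)
    (hsym : ∀ (σ : Equiv.Perm (Fin n)) (x : Fin n → ℝ), pwa a c (x ∘ σ) = pwa a c x)
    (X U K : Matrix (Fin n) (Fin n) ℝ) (hX : X.IsSymm) (hU : Uᵀ * U = 1)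
    (hUX : X = U * diagonal (lamVec X) * Uᵀ) (e : Fin n → ℝ) (m : ℝ)
    (hm : ∀ i ∈ iotaA a c (lamVec X), a i ⬝ᵥ e ≤ m) (hK : K.IsSymm)
    (hK0 : ∀ k l, lamVec X k = lamVec X l → K k l = 0)
    (hlow : ∀ t : ℝ, pwa a c (lamVec X) + t * m ≤
      pwa a c (lamVec (X + t • (U * (diagonal e + K) * Uᵀ)))) :
    dirDeriv (fun X => pwa a c (lamVec X)) X (U * (diagonal e + K) * Uᵀ) = m := by
  set x := lamVec X with hx
  set G := U * (diagonal e + K) * Uᵀ with hG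
  have hGs : G.IsSymm := symm_conj _ _ ((isSymm_diagonal e).add hK)
  let S : Matrix (Fin n) (Fin n) ℝ := Matrix.of fun k l => K k l / (x l - x k)
  have hS : Sᵀ = -S := by
    ext k l
    simp only [S, transpose_apply, Matrix.neg_apply, of_apply]
    rw [hK.apply k l, ← neg_sub, div_neg]
  have hSL : S * diagonal x - diagonal x * S = K := by
    ext k l
    simp only [Matrix.sub_apply, mul_diagonal, diagonal_mul, S, of_apply]
    by_cases h : x k = x l
    · rw [hK0 k l h]; simp
    · have : x l - x k ≠ 0 := sub_ne_zero.mpr (Ne.symm h)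
      field_simp
  let Z : ℝ → Matrix (Fin n) (Fin n) ℝ := fun s => U * (NormedSpace.exp (s • S) *
    (diagonal x + s • diagonal e) * NormedSpace.exp (s • (-S))) * Uᵀ
  have hZ : ∀ s, Z s = (U * NormedSpace.exp (s • S)) * diagonal (x + s • e) *
      (U * NormedSpace.exp (s • S))ᵀ := by
    intro s
    have : NormedSpace.exp (s • (-S)) = (NormedSpace.exp (s • S))ᵀ := by
      rw [← Matrix.exp_transpose, transpose_smul, hS]
    simp only [Z, this, transpose_mul, Matrix.mul_assoc]
    have h2 : diagonal x + s • diagonal e = diagonal (x + s • e) := by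
      rw [← diagonal_smul, diagonal_add]; rfl
    rw [h2]
  have hO : ∀ s : ℝ, (U * NormedSpace.exp (s • S))ᵀ * (U * NormedSpace.exp (s • S)) = 1 := by
    intro s
    rw [transpose_mul, Matrix.mul_assoc, ← Matrix.mul_assoc Uᵀ, hU, Matrix.one_mul]
    exact exp_skew_orth _ (by rw [transpose_smul, hS, smul_neg])
  have hZs : ∀ s, (Z s).IsSymm := fun s => by
    rw [hZ]; exact symm_conj _ _ (isSymm_diagonal _)
  have hZv : ∀ s, pwa a c (lamVec (Z s)) = pwa a c (x + s • e) := fun s => by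
    rw [hZ]; exact th_eq a c hsym _ (hO s) _
  let C := ∑ i, ∑ k, |a i k|
  have hlim : Tendsto (fun s : ℝ => m + C * ∑ l, ∑ k, |G l k - (Z s l k - X l k) / s|)
      (𝓝[>] (0:ℝ)) (𝓝 (m + C * ∑ l : Fin n, ∑ k : Fin n, (0:ℝ))) := by
    refine tendsto_const_nhds.add (tendsto_const_nhds.mul ?_)
    refine tendsto_finsetSum _ fun l _ => tendsto_finsetSum _ fun k _ => ?_
    have h := curve_tendsto S (diagonal x) (diagonal e) U l k
    rw [hSL, ← hUX] at h
    have h2 := (tendsto_const_nhds (x := G l k)).sub h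
    have h3 := h2.abs
    rw [← hG, sub_self, abs_zero] at h3
    exact h3
  simp only [Finset.sum_const_zero, mul_zero, add_zero] at hlim
  apply dd_eq_of
  refine tendsto_of_tendsto_of_tendsto_of_le_of_le' tendsto_const_nhds hlim ?_ ?_
  · filter_upwards [self_mem_nhdsWithin] with s hs
    have hs : 0 < s := hs
    rw [le_div_iff₀ hs]
    have := hlow s
    linarith
  · filter_upwards [self_mem_nhdsWithin, pwa_small a c x e m hm] with s hs h1
    have hs : 0 < s := hs
    rw [div_le_iff₀ hs]
    have h2 := th_lip a c hsym (X + s • G) (Z s) (hX.add (hGs.smul s)) (hZs s)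
    rw [hZv] at h2
    have h3 : ∑ l, ∑ k, |(X + s • G) l k - Z s l k| =
        (∑ l, ∑ k, |G l k - (Z s l k - X l k) / s|) * s := by
      simp only [Finset.sum_mul]
      refine Finset.sum_congr rfl fun l _ => Finset.sum_congr rfl fun k _ => ?_
      rw [← abs_of_pos hs, ← abs_mul, abs_of_pos hs]
      congr 1
      simp only [Matrix.add_apply, Matrix.smul_apply, smul_eq_mul]
      field_simp
      ring
    rw [h3] at h2
    change _ ≤ _ + C * _ at h2
    rw [add_mul, mul_assoc]
    linarith

end

end S6

namespace S6

variable {n p : ℕ}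

/-- Convex hull of the `a i`, `i ∈ s`. -/
def hull (a : Fin p → Fin n → ℝ) (s : Set (Fin p)) : Set (Fin n → ℝ) :=
  (fun u : Fin p → ℝ => ∑ j, u j • a j) '' {u | u ∈ stdSimplex ℝ (Fin p) ∧ ∀ j, j ∉ s → u j = 0}

lemma hull_convex (a : Fin p → Fin n → ℝ) (s : Set (Fin p)) : Convex ℝ (hull a s) := by
  have hl : IsLinearMap ℝ (fun u : Fin p → ℝ => ∑ j, u j • a j) :=
    ⟨fun u v => by simp [add_smul, Finset.sum_add_distrib],
      fun t u => by simp [Finset.smul_sum, mul_smul]⟩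
  refine Convex.is_linear_image ?_ hl
  intro u hu v hv r t hr ht hrt
  refine ⟨convex_stdSimplex ℝ (Fin p) hu.1 hv.1 hr ht hrt, fun j hj => ?_⟩
  simp [hu.2 j hj, hv.2 j hj]

lemma hull_compact (a : Fin p → Fin n → ℝ) (s : Set (Fin p)) : IsCompact (hull a s) := by
  refine IsCompact.image ?_ (by fun_prop)
  refine (isCompact_stdSimplex ℝ (Fin p)).inter_right (t := {u | ∀ j, j ∉ s → u j = 0}) ?_
  simp only [Set.ofPred_forall]
  refine isClosed_iInter fun j => isClosed_iInter fun _ => ?_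
  exact isClosed_eq (continuous_apply j) continuous_const

lemma mem_hull (a : Fin p → Fin n → ℝ) (s : Set (Fin p)) (i : Fin p) (hi : i ∈ s) :
    a i ∈ hull a s := by
  refine ⟨Pi.single i 1, ⟨single_mem_stdSimplex ℝ i, fun j hj => ?_⟩, ?_⟩
  · have : j ≠ i := fun h => hj (h ▸ hi)
    simp [this]
  · simp [Pi.single_apply, ite_smul]

lemma dual_vec (f : StrongDual ℝ (Fin n → ℝ)) : ∃ e : Fin n → ℝ, ∀ x, f x = x ⬝ᵥ e := by
  refine ⟨fun k => f (Pi.single k 1), fun x => ?_⟩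
  conv_lhs => rw [pi_eq_sum_univ' x]
  rw [map_sum]
  refine Finset.sum_congr rfl fun k _ => ?_
  rw [map_smul, smul_eq_mul]

lemma sep_rep (a : Fin p → Fin n → ℝ) (s : Set (Fin p)) (y : Fin n → ℝ)
    (h : ∀ (e : Fin n → ℝ) (m : ℝ), (∀ i ∈ s, a i ⬝ᵥ e ≤ m) → y ⬝ᵥ e ≤ m) :
    ∃ u : Fin p → ℝ, (∀ j, 0 ≤ u j) ∧ (∀ j, j ∉ s → u j = 0) ∧
        (∑ j, u j) = 1 ∧ y = ∑ j, u j • a j := by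
  by_cases hy : y ∈ hull a s
  · obtain ⟨u, hu, rfl⟩ := hy
    exact ⟨u, hu.1.1, hu.2, hu.1.2, rfl⟩
  · exfalso
    obtain ⟨f, u, h1, h2⟩ := geometric_hahn_banach_closed_point (hull_convex a s)
      (hull_compact a s).isClosed hy
    obtain ⟨e, he⟩ := dual_vec f
    have := h e u fun i hi => by
      rw [← he]; exact (h1 _ (mem_hull a s i hi)).le
    rw [← he] at this
    linarith

section
variable [NeZero p] (a : Fin p → Fin n → ℝ) (c : Fin p → ℝ)

lemma full_weights (x y : Fin n → ℝ)
    (hne : ∃ u : Fin p → ℝ, (∀ j, 0 ≤ u j) ∧ (∀ j, j ∉ iotaA a c x → u j = 0) ∧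
        (∑ j, u j) = 1 ∧ y = ∑ j, u j • a j) :
    ∃ u : Fin p → ℝ, (∀ j, 0 ≤ u j) ∧ (∀ j, j ∉ iotaA a c x → u j = 0) ∧
        (∑ j, u j) = 1 ∧ y = ∑ j, u j • a j ∧ ∀ j, j ∈ etaA a c x y → 0 < u j := by
  have : ∀ i : Fin p, ∃ u : Fin p → ℝ, (∀ j, 0 ≤ u j) ∧ (∀ j, j ∉ iotaA a c x → u j = 0) ∧
        (∑ j, u j) = 1 ∧ y = ∑ j, u j • a j ∧ (i ∈ etaA a c x y → 0 < u i) := by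
    intro i
    by_cases hi : i ∈ etaA a c x y
    · obtain ⟨u, h1, h2, h3, h4, h5⟩ := hi
      exact ⟨u, h1, h2, h3, h4, fun _ => h5⟩
    · obtain ⟨u, h1, h2, h3, h4⟩ := hne
      exact ⟨u, h1, h2, h3, h4, fun h => absurd h hi⟩
  choose U h1 h2 h3 h4 h5 using this
  have hp : (0:ℝ) < p := by exact_mod_cast Nat.pos_of_ne_zero (NeZero.ne p)
  refine ⟨fun j => (p:ℝ)⁻¹ * ∑ i, U i j, fun j => ?_, fun j hj => ?_, ?_, ?_, fun j hj => ?_⟩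
  · exact mul_nonneg (inv_nonneg.mpr hp.le) (Finset.sum_nonneg fun i _ => h1 i j)
  · simp [h2 _ j hj]
  · rw [← Finset.mul_sum, Finset.sum_comm]
    simp [h3, hp.ne']
  · simp only [mul_smul, Finset.sum_smul]
    rw [← Finset.smul_sum, Finset.sum_comm]
    simp only [← h4]
    simp [← Nat.cast_smul_eq_nsmul ℝ, smul_smul, hp.ne']
  · refine mul_pos (inv_pos.mpr hp) ?_
    exact Finset.sum_pos' (fun i _ => h1 i j) ⟨j, Finset.mem_univ _, h5 j hj⟩

lemma eta_sub (x y : Fin n → ℝ) (i : Fin p) (hi : i ∈ etaA a c x y) : i ∈ iotaA a c x := by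
  obtain ⟨u, h1, h2, h3, h4, h5⟩ := hi
  by_contra h
  rw [h2 i h] at h5
  exact lt_irrefl _ h5

lemma exists_e0 (x y : Fin n → ℝ)
    (hne : ∃ u : Fin p → ℝ, (∀ j, 0 ≤ u j) ∧ (∀ j, j ∉ iotaA a c x → u j = 0) ∧
        (∑ j, u j) = 1 ∧ y = ∑ j, u j • a j) :
    ∃ e : Fin n → ℝ, (∀ j ∈ etaA a c x y, a j ⬝ᵥ e = y ⬝ᵥ e) ∧
      ∀ j ∈ iotaA a c x, j ∉ etaA a c x y → a j ⬝ᵥ e < y ⬝ᵥ e := by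
  obtain ⟨u, hu0, huι, hu1, huy, hupos⟩ := full_weights a c x y hne
  set η := etaA a c x y with hη
  let b : Fin p → Fin n → ℝ := fun j => if j ∈ η then a j - y else 0
  let S : Submodule ℝ (Fin n → ℝ) := Submodule.span ℝ (Set.range b)
  let s : Set (Fin p) := iotaA a c x \ η
  have hQc : Convex ℝ ((fun q => q + (-y)) '' hull a s) := by
    have := (hull_convex a s).translate (-y)
    simpa [add_comm] using this
  have hQk : IsCompact ((fun q => q + (-y)) '' hull a s) :=
    (hull_compact a s).image (by fun_prop)
  have hSc : IsClosed (S : Set (Fin n → ℝ)) := Submodule.closed_of_finiteDimensional S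
  have huη : ∀ j, j ∉ η → u j = 0 := by
    intro j hj
    by_contra h
    exact hj ⟨u, hu0, huι, hu1, huy, lt_of_le_of_ne (hu0 j) (Ne.symm h)⟩
  have hdisj : Disjoint ((fun q => q + (-y)) '' hull a s) (S : Set (Fin n → ℝ)) := by
    rw [Set.disjoint_left]
    rintro _ ⟨_, ⟨μ, ⟨⟨hμ0, hμ1⟩, hμs⟩, rfl⟩, rfl⟩ hS
    obtain ⟨ν, hν⟩ := (Submodule.mem_span_range_iff_exists_fun ℝ).mp hS
    let ν' : Fin p → ℝ := fun j => if j ∈ η then ν j else 0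
    let N := ∑ j, ν' j
    have e1 : ∑ j, ν j • b j = ∑ j, ν' j • a j - N • y := by
      rw [Finset.sum_smul, ← Finset.sum_sub_distrib]
      refine Finset.sum_congr rfl fun j _ => ?_
      by_cases hj : j ∈ η <;> simp [b, ν', hj, smul_sub]
    have e2 : ∑ j, μ j • a j = y + (∑ j, ν' j • a j - N • y) := by
      rw [← e1, hν]; simp only []; abel_nf
    have hsm : ∀ᶠ ε in 𝓝[>] (0:ℝ), ∀ j, j ∈ η → 0 < u j + ε * (μ j - ν' j + (N - 1) * u j) := by
      refine eventually_all.mpr fun j => ?_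
      by_cases hj : j ∈ η
      · have hc : Continuous fun ε : ℝ => u j + ε * (μ j - ν' j + (N - 1) * u j) := by fun_prop
        have : ∀ᶠ ε in 𝓝 (0:ℝ), 0 < u j + ε * (μ j - ν' j + (N - 1) * u j) := by
          apply hc.continuousAt.eventually_const_lt
          simpa using hupos j hj
        filter_upwards [this.filter_mono nhdsWithin_le_nhds] with ε h _ using h
      · exact Eventually.of_forall fun ε h => absurd h hj
    obtain ⟨ε, h1, h2⟩ := (hsm.and self_mem_nhdsWithin).exists
    have hε : 0 < ε := h2
    have hoff : ∀ j, j ∉ η → u j + ε * (μ j - ν' j + (N - 1) * u j) = ε * μ j := by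
      intro j hj
      simp [huη j hj, ν', hj]
    have : ∃ i, 0 < μ i := by
      by_contra hcon
      push Not at hcon
      have : ∑ j, μ j ≤ 0 := Finset.sum_nonpos fun j _ => hcon j
      linarith
    obtain ⟨i, hi⟩ := this
    have his : i ∈ s := by
      by_contra h
      rw [hμs i h] at hi
      exact lt_irrefl _ hi
    refine his.2 ⟨fun j => u j + ε * (μ j - ν' j + (N - 1) * u j), fun j => ?_, fun j hj => ?_,
      ?_, ?_, ?_⟩
    · by_cases hj : j ∈ η
      · exact (h1 j hj).le
      · simp only []
        rw [hoff j hj]; exact mul_nonneg hε.le (hμ0 j)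
    · have hjη : j ∉ η := fun h => hj (eta_sub a c x y j h)
      simp only []
      rw [hoff j hjη, hμs j (fun h => hj h.1), mul_zero]
    · rw [Finset.sum_add_distrib, ← Finset.mul_sum, Finset.sum_add_distrib,
        Finset.sum_sub_distrib, ← Finset.mul_sum, hu1, hμ1]
      change 1 + ε * (1 - N + (N - 1) * 1) = 1
      ring
    · have : ∀ j, (u j + ε * (μ j - ν' j + (N - 1) * u j)) • a j =
          u j • a j + ε • (μ j • a j - ν' j • a j + (N - 1) • (u j • a j)) := by
        intro j; module
      simp only [this]
      rw [Finset.sum_add_distrib, ← Finset.smul_sum, Finset.sum_add_distrib,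
        Finset.sum_sub_distrib, ← Finset.smul_sum, ← huy, e2]
      module
    · simp only []
      rw [hoff i his.2]
      exact mul_pos hε hi
  obtain ⟨f, v, w, h1, h2, h3⟩ :=
    geometric_hahn_banach_compact_closed hQc hQk S.convex hSc hdisj
  obtain ⟨e, he⟩ := dual_vec f
  have hw : w < 0 := by simpa using h3 0 S.zero_mem
  have hS0 : ∀ z ∈ S, f z = 0 := by
    intro z hz
    by_contra hne
    have := h3 ((w / f z) • z) (S.smul_mem _ hz)
    rw [map_smul, smul_eq_mul, div_mul_cancel₀ _ hne] at this
    exact lt_irrefl _ this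
  refine ⟨e, fun j hj => ?_, fun j hj hj' => ?_⟩
  · have : f (a j - y) = 0 := by
      apply hS0
      apply Submodule.subset_span
      exact ⟨j, by simp [b, hj]⟩
    rw [map_sub, he, he] at this
    linarith
  · have := h1 (a j + -y) ⟨a j, mem_hull a s j ⟨hj, hj'⟩, rfl⟩
    rw [map_add, map_neg, he, he] at this
    linarith

end

end S6

namespace S6

variable {n p : ℕ}

/-- The vector `x e_i + y e_j`. -/
def vv (i j : Fin n) (x y : ℝ) : Fin n → ℝ := Pi.single i x + Pi.single j y

/-- Householder reflection along `x e_i + y e_j`. -/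
def RR (i j : Fin n) (x y : ℝ) : Matrix (Fin n) (Fin n) ℝ :=
  1 - (2 / (x ^ 2 + y ^ 2)) • vecMulVec (vv i j x y) (vv i j x y)

lemma vv_dot (i j : Fin n) (x y : ℝ) (g : Fin n → ℝ) : vv i j x y ⬝ᵥ g = x * g i + y * g j := by
  simp [vv, add_dotProduct]

lemma vv_i (i j : Fin n) (hij : i ≠ j) (x y : ℝ) : vv i j x y i = x := by simp [vv, hij]

lemma vv_j (i j : Fin n) (hij : i ≠ j) (x y : ℝ) : vv i j x y j = y := by simp [vv, hij.symm]

lemma RR_symm (i j : Fin n) (x y : ℝ) : (RR i j x y)ᵀ = RR i j x y := by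
  simp [RR, transpose_vecMulVec]

/-- Conjugation by the reflection. -/
lemma RR_conj (i j : Fin n) (x y : ℝ) (A : Matrix (Fin n) (Fin n) ℝ) (hA : A.IsSymm) :
    RR i j x y * A * RR i j x y = A
      - (2 / (x ^ 2 + y ^ 2)) • (vecMulVec (vv i j x y) (A *ᵥ vv i j x y)
          + vecMulVec (A *ᵥ vv i j x y) (vv i j x y))
      + ((2 / (x ^ 2 + y ^ 2)) ^ 2 * (vv i j x y ⬝ᵥ (A *ᵥ vv i j x y))) •
          vecMulVec (vv i j x y) (vv i j x y) := by
  have h1 : vv i j x y ᵥ* A = A *ᵥ vv i j x y := by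
    rw [← mulVec_transpose, hA.eq]
  have h2 : vecMulVec (vv i j x y) (vv i j x y) * A * vecMulVec (vv i j x y) (vv i j x y) =
      (vv i j x y ⬝ᵥ (A *ᵥ vv i j x y)) • vecMulVec (vv i j x y) (vv i j x y) := by
    rw [vecMulVec_mul, h1, vecMulVec_mul_vecMulVec, dotProduct_comm]
    ext k l
    simp only [Matrix.smul_apply, vecMulVec_apply, smul_eq_mul, Pi.smul_apply]
    ring
  have h3 : vecMulVec (vv i j x y) (vv i j x y) * A = vecMulVec (vv i j x y) (A *ᵥ vv i j x y) := by
    rw [vecMulVec_mul, h1]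
  have h4 : A * vecMulVec (vv i j x y) (vv i j x y) = vecMulVec (A *ᵥ vv i j x y) (vv i j x y) := by
    rw [mul_vecMulVec]
  have h5 : RR i j x y * A * RR i j x y = A
      - (2 / (x ^ 2 + y ^ 2)) • (vecMulVec (vv i j x y) (vv i j x y) * A
          + A * vecMulVec (vv i j x y) (vv i j x y))
      + ((2 / (x ^ 2 + y ^ 2)) ^ 2) •
        (vecMulVec (vv i j x y) (vv i j x y) * A * vecMulVec (vv i j x y) (vv i j x y)) := by
    unfold RR
    generalize vecMulVec (vv i j x y) (vv i j x y) = M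
    simp only [Matrix.sub_mul, Matrix.mul_sub, Matrix.one_mul, Matrix.mul_one, Matrix.smul_mul,
      Matrix.mul_smul]
    module
  rw [h5, h2, h3, h4, smul_smul]

lemma RR_diag (i j : Fin n) (hij : i ≠ j) (x y : ℝ) (hxy : x ^ 2 + y ^ 2 ≠ 0) (l : Fin n → ℝ)
    (hl : l i = l j) : RR i j x y * diagonal l * RR i j x y = diagonal l := by
  have h1 : diagonal l *ᵥ vv i j x y = l i • vv i j x y := by
    ext k
    rw [mulVec_diagonal]
    by_cases hk : k = i
    · subst hk; simp
    · by_cases hk' : k = j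
      · subst hk'; simp [hl]
      · simp [vv, hk, hk']
  rw [RR_conj _ _ _ _ _ (isSymm_diagonal l), h1, dotProduct_smul, vv_dot, vv_i i j hij, vv_j i j hij]
  ext k m
  simp only [Matrix.sub_apply, Matrix.add_apply, Matrix.smul_apply, vecMulVec_apply, smul_eq_mul,
    Pi.smul_apply]
  field_simp
  ring

lemma RR_orth (i j : Fin n) (hij : i ≠ j) (x y : ℝ) (hxy : x ^ 2 + y ^ 2 ≠ 0) :
    (RR i j x y)ᵀ * RR i j x y = 1 := by
  have := RR_diag i j hij x y hxy (fun _ => 1) rfl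
  rw [diagonal_one, Matrix.mul_one] at this
  rw [RR_symm, this]

lemma RR_dot (i j : Fin n) (hij : i ≠ j) (x y : ℝ) (hxy : x ^ 2 + y ^ 2 ≠ 0)
    (A : Matrix (Fin n) (Fin n) ℝ) (hA : A.IsSymm) (w : Fin n → ℝ) :
    w ⬝ᵥ dg (RR i j x y) A = w ⬝ᵥ (fun k => A k k) + 4 / (x ^ 2 + y ^ 2) ^ 2 *
      ((w i - w j) * (x * y * (-(x * y * (A i i - A j j)) + (x ^ 2 - y ^ 2) * A i j))) := by
  have hv : ∀ k, (A *ᵥ vv i j x y) k = x * A k i + y * A k j := by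
    intro k
    change A k ⬝ᵥ vv i j x y = _
    rw [dotProduct_comm, vv_dot]
  have h1 : dg (RR i j x y) A = (fun k => A k k) + (fun k => vv i j x y k *
      (-(2 * (2 / (x ^ 2 + y ^ 2)) * (A *ᵥ vv i j x y) k) + ((2 / (x ^ 2 + y ^ 2)) ^ 2 *
        (vv i j x y ⬝ᵥ (A *ᵥ vv i j x y))) * vv i j x y k)) := by
    ext k
    simp only [dg]
    rw [RR_symm, RR_conj _ _ _ _ _ hA]
    simp only [Matrix.sub_apply, Matrix.add_apply, Matrix.smul_apply, vecMulVec_apply, smul_eq_mul,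
      Pi.add_apply]
    ring
  have h2 : ∀ g : Fin n → ℝ, w ⬝ᵥ (fun k => vv i j x y k * g k) =
      x * (w i * g i) + y * (w j * g j) := by
    intro g
    rw [← vv_dot i j x y (fun k => w k * g k)]
    exact Finset.sum_congr rfl fun k _ => by ring
  rw [h1, dotProduct_add, h2, vv_dot, hv, hv, vv_i i j hij, vv_j i j hij, hA.apply i j]
  congr 1
  field_simp
  ring

/-- Rotating a diagonal difference produces an off-diagonal element. -/
lemma RR_off (i j : Fin n) (hij : i ≠ j) :
    RR i j 2 1 * diagonal (vv i j 1 (-1)) * RR i j 2 1 =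
      (-(7:ℝ) / 25) • diagonal (vv i j 1 (-1)) +
        ((24:ℝ) / 25) • (Matrix.single i j (1:ℝ) + Matrix.single j i 1) := by
  have h1 : diagonal (vv i j 1 (-1)) *ᵥ vv i j 2 1 = vv i j 2 (-1) := by
    ext k
    rw [mulVec_diagonal]
    by_cases hk : k = i
    · subst hk; simp [vv_i _ _ hij]
    · by_cases hk' : k = j
      · subst hk'; simp [vv_j _ _ hij]
      · simp [vv, hk, hk']
  rw [RR_conj _ _ _ _ _ (isSymm_diagonal _), h1, vv_dot, vv_i i j hij, vv_j i j hij]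
  ext k l
  simp only [Matrix.sub_apply, Matrix.add_apply, Matrix.smul_apply, vecMulVec_apply, smul_eq_mul,
    Matrix.single_apply, diagonal_apply]
  by_cases hk : k = i
  · subst hk
    by_cases hl : l = k
    · subst hl; simp [vv_i _ _ hij, hij.symm]; norm_num
    · by_cases hl' : l = j
      · subst hl'; simp [vv_i _ _ hij, vv_j _ _ hij, hij, hij.symm]; norm_num
      · simp [vv, hl, hl', hij, Ne.symm hl, Ne.symm hl', hij.symm]
  · by_cases hk' : k = j
    · subst hk'
      by_cases hl : l = k
      · subst hl; simp [vv_j _ _ hij, hij]; norm_num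
      · by_cases hl' : l = i
        · subst hl'; simp [vv_i _ _ hij, vv_j _ _ hij, hij, hij.symm]; norm_num
        · simp [vv, hl, hl', hij, Ne.symm hl, Ne.symm hl', hij.symm]
    · simp [vv, hk, hk', Ne.symm hk, Ne.symm hk']

end S6

namespace S6

variable {n p : ℕ}

lemma OSet_RR (X U : Matrix (Fin n) (Fin n) ℝ) (hU : U ∈ OSet X) (i j : Fin n) (hij : i ≠ j)
    (x y : ℝ) (hxy : x ^ 2 + y ^ 2 ≠ 0) (hl : lamVec X i = lamVec X j) :
    U * RR i j x y ∈ OSet X := by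
  obtain ⟨h1, h2⟩ := hU
  have h3 := RR_orth i j hij x y hxy
  have h4 := RR_diag i j hij x y hxy (lamVec X) hl
  refine ⟨?_, ?_⟩
  · rw [transpose_mul, Matrix.mul_assoc, ← Matrix.mul_assoc Uᵀ, h1, Matrix.one_mul, h3]
  · calc X = U * diagonal (lamVec X) * Uᵀ := h2
      _ = U * (RR i j x y * diagonal (lamVec X) * RR i j x y) * Uᵀ := by rw [h4]
      _ = _ := by rw [transpose_mul, RR_symm]; simp only [Matrix.mul_assoc]

lemma OSet_perm (X U : Matrix (Fin n) (Fin n) ℝ) (hU : U ∈ OSet X) (σ : Equiv.Perm (Fin n))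
    (hl : lamVec X ∘ σ = lamVec X) : U.submatrix id σ ∈ OSet X := by
  obtain ⟨h1, h2⟩ := hU
  refine ⟨?_, ?_⟩
  · rw [transpose_submatrix, ← Matrix.submatrix_mul Uᵀ U σ id σ Function.bijective_id, h1,
      submatrix_one_equiv]
  · have h3 : (diagonal (lamVec X)).submatrix σ σ = diagonal (lamVec X) := by
      rw [submatrix_diagonal_equiv, hl]
    rw [← h3, transpose_submatrix, submatrix_mul_equiv, submatrix_mul_equiv]
    simpa using h2

lemma dg_RR (U R H : Matrix (Fin n) (Fin n) ℝ) : dg (U * R) H = dg R (Uᵀ * H * U) := by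
  unfold dg
  simp only [transpose_mul, Matrix.mul_assoc]

lemma conj_perm (U H : Matrix (Fin n) (Fin n) ℝ) (σ : Equiv.Perm (Fin n)) :
    (U.submatrix id σ)ᵀ * H * U.submatrix id σ = (Uᵀ * H * U).submatrix σ σ := by
  ext i j
  simp [Matrix.mul_apply]

lemma symm_conj' (U : Matrix (Fin n) (Fin n) ℝ) (X : Matrix (Fin n) (Fin n) ℝ) (hX : X.IsSymm) :
    (Uᵀ * X * U).IsSymm := by
  simpa using symm_conj Uᵀ X hX

lemma mip_dg (Y U H : Matrix (Fin n) (Fin n) ℝ) (hY : Y.IsSymm) (hU : U ∈ OSet Y) :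
    mip Y H = lamVec Y ⬝ᵥ dg U H := by
  unfold mip
  rw [hY.eq]
  conv_lhs => rw [hU.2]
  rw [Matrix.mul_assoc, Matrix.mul_assoc, trace_mul_comm, Matrix.mul_assoc, Matrix.trace]
  simp only [Matrix.diag, diagonal_mul, dg, dotProduct]

section

lemma y_rep [NeZero p] (a : Fin p → Fin n → ℝ) (c : Fin p → ℝ)
    (hsym : ∀ (σ : Equiv.Perm (Fin n)) (x : Fin n → ℝ), pwa a c (x ∘ σ) = pwa a c x)
    (X Y : Matrix (Fin n) (Fin n) ℝ)
    (hY : Y ∈ msubdiff (fun X => pwa a c (lamVec X)) X)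
    (U : Matrix (Fin n) (Fin n) ℝ) (hU : U ∈ OSet X ∩ OSet Y) :
    ∃ u : Fin p → ℝ, (∀ j, 0 ≤ u j) ∧ (∀ j, j ∉ iotaA a c (lamVec X) → u j = 0) ∧
      ∑ j, u j = 1 ∧ lamVec Y = ∑ j, u j • a j := by
  apply sep_rep
  intro e m hm
  obtain ⟨s, hs, hs0⟩ := ((pwa_small a c (lamVec X) e m hm).and self_mem_nhdsWithin).exists
  have hs0 : 0 < s := hs0
  have h1 := hY.2 (U * diagonal (lamVec X + s • e) * Uᵀ) (symm_conj _ _ (isSymm_diagonal _))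
  have h2 : U * diagonal (lamVec X + s • e) * Uᵀ - X = s • (U * diagonal e * Uᵀ) := by
    conv_lhs => rw [hU.1.2]
    have : diagonal (lamVec X + s • e) = diagonal (lamVec X) + s • diagonal e := by
      rw [← diagonal_smul, diagonal_add]; rfl
    rw [← hU.1.2, this, Matrix.mul_add, Matrix.add_mul, ← hU.1.2]
    simp
  rw [h2, mip_dg Y U _ hY.1 hU.2, dg_smul, dg_self U hU.1.1] at h1
  simp only at h1
  rw [th_eq a c hsym U hU.1.1, dotProduct_smul, smul_eq_mul] at h1
  have : s * (lamVec Y ⬝ᵥ e) ≤ s * m := by linarith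
  exact le_of_mul_le_mul_left this hs0

/-- `H` critical. -/
def Cr [NeZero p] (a : Fin p → Fin n → ℝ) (c : Fin p → ℝ)
    (X Y : Matrix (Fin n) (Fin n) ℝ) : Set (Matrix (Fin n) (Fin n) ℝ) := critM1 (fun X => pwa a c (lamVec X)) X Y

lemma cr_le [NeZero p] (a : Fin p → Fin n → ℝ) (c : Fin p → ℝ)
    (hsym : ∀ (σ : Equiv.Perm (Fin n)) (x : Fin n → ℝ), pwa a c (x ∘ σ) = pwa a c x)
    (X Y : Matrix (Fin n) (Fin n) ℝ) (hX : X.IsSymm)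
    (H : Matrix (Fin n) (Fin n) ℝ) (hH : H ∈ Cr a c X Y) (U : Matrix (Fin n) (Fin n) ℝ)
    (hU : U ∈ OSet X) (i : Fin p) (hi : i ∈ iotaA a c (lamVec X)) :
    a i ⬝ᵥ dg U H ≤ mip Y H := by
  rw [← hH.2]
  exact dd_ge a c hsym X H hX hH.1 U hU.1 hU.2 i hi

lemma wavg (a : Fin p → Fin n → ℝ) (u : Fin p → ℝ) (y d : Fin n → ℝ) (hy : y = ∑ j, u j • a j) :
    y ⬝ᵥ d = ∑ j, u j * (a j ⬝ᵥ d) := by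
  rw [hy, sum_dotProduct]
  simp [smul_dotProduct]

lemma cr_le_y [NeZero p] (a : Fin p → Fin n → ℝ) (c : Fin p → ℝ)
    (hsym : ∀ (σ : Equiv.Perm (Fin n)) (x : Fin n → ℝ), pwa a c (x ∘ σ) = pwa a c x)
    (X Y : Matrix (Fin n) (Fin n) ℝ) (hX : X.IsSymm)
    (hY : Y ∈ msubdiff (fun X => pwa a c (lamVec X)) X)
    (U0 : Matrix (Fin n) (Fin n) ℝ) (hU0 : U0 ∈ OSet X ∩ OSet Y)
    (H : Matrix (Fin n) (Fin n) ℝ) (hH : H ∈ Cr a c X Y) (U : Matrix (Fin n) (Fin n) ℝ)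
    (hU : U ∈ OSet X) : lamVec Y ⬝ᵥ dg U H ≤ mip Y H := by
  obtain ⟨u, h0, h1, h2, h3⟩ := y_rep a c hsym X Y hY U0 hU0
  rw [wavg a u _ _ h3]
  calc ∑ j, u j * (a j ⬝ᵥ dg U H) ≤ ∑ j, u j * mip Y H := by
        apply Finset.sum_le_sum
        intro j _
        by_cases hj : j ∈ iotaA a c (lamVec X)
        · exact mul_le_mul_of_nonneg_left (cr_le a c hsym X Y hX H hH U hU j hj) (h0 j)
        · simp [h1 j hj]
    _ = mip Y H := by rw [← Finset.sum_mul, h2, one_mul]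

lemma cr_eta [NeZero p] (a : Fin p → Fin n → ℝ) (c : Fin p → ℝ)
    (hsym : ∀ (σ : Equiv.Perm (Fin n)) (x : Fin n → ℝ), pwa a c (x ∘ σ) = pwa a c x)
    (X Y : Matrix (Fin n) (Fin n) ℝ) (hX : X.IsSymm)
    (hY : Y ∈ msubdiff (fun X => pwa a c (lamVec X)) X)
    (H : Matrix (Fin n) (Fin n) ℝ) (hH : H ∈ Cr a c X Y) (U : Matrix (Fin n) (Fin n) ℝ)
    (hU : U ∈ OSet X ∩ OSet Y) (w : Fin p) (hw : w ∈ etaA a c (lamVec X) (lamVec Y)) :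
    a w ⬝ᵥ dg U H = mip Y H := by
  obtain ⟨u, h0, h1, h2, h3, h4⟩ := hw
  have h5 := mip_dg Y U H hY.1 hU.2
  rw [wavg a u _ _ h3] at h5
  have h6 : ∑ j, u j * (mip Y H - a j ⬝ᵥ dg U H) = 0 := by
    simp only [mul_sub, Finset.sum_sub_distrib]
    rw [← Finset.sum_mul, h2, one_mul, ← h5, sub_self]
  rw [Finset.sum_eq_zero_iff_of_nonneg] at h6
  · have := h6 w (Finset.mem_univ _)
    rcases mul_eq_zero.mp this with h | h
    · exact absurd h h4.ne'
    · linarith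
  · intro j _
    by_cases hj : j ∈ iotaA a c (lamVec X)
    · exact mul_nonneg (h0 j) (sub_nonneg.mpr (cr_le a c hsym X Y hX H hH U hU.1 j hj))
    · simp [h1 j hj]

/-- Elementary scalar fact. -/
lemma scal (d D B : ℝ) (hd : d ≠ 0)
    (h : ∀ x : ℝ, 0 < x → d * (x * (-(x * D) + (x ^ 2 - 1) * B)) ≤ 0) : B = 0 := by
  have key : ∀ r : ℝ, d * (r * B - D) ≤ 0 := by
    intro r
    have hs : Real.sqrt (r ^ 2 + 4) ^ 2 = r ^ 2 + 4 := Real.sq_sqrt (by positivity)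
    have hp : |r| < Real.sqrt (r ^ 2 + 4) := by
      rw [← Real.sqrt_sq_eq_abs]
      exact Real.sqrt_lt_sqrt (sq_nonneg r) (by linarith)
    have hx : 0 < (r + Real.sqrt (r ^ 2 + 4)) / 2 := by
      have := neg_abs_le r
      linarith
    have h1 := h _ hx
    set x := (r + Real.sqrt (r ^ 2 + 4)) / 2 with hxd
    have hx2 : x ^ 2 - 1 = r * x := by rw [hxd]; nlinarith
    rw [hx2] at h1
    have h2 : d * (x * (-(x * D) + r * x * B)) = x ^ 2 * (d * (r * B - D)) := by ring
    rw [h2] at h1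
    by_contra hc
    push Not at hc
    have := mul_pos (pow_pos hx 2) hc
    linarith
  by_contra hB
  have h1 := key ((d * D + 1) / (d * B))
  have h2 : d * ((d * D + 1) / (d * B) * B - D) = 1 := by field_simp; ring
  rw [h2] at h1
  linarith

lemma nec_i [NeZero p] (a : Fin p → Fin n → ℝ) (c : Fin p → ℝ)
    (hsym : ∀ (σ : Equiv.Perm (Fin n)) (x : Fin n → ℝ), pwa a c (x ∘ σ) = pwa a c x)
    (X Y : Matrix (Fin n) (Fin n) ℝ) (hX : X.IsSymm)
    (hY : Y ∈ msubdiff (fun X => pwa a c (lamVec X)) X)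
    (H : Matrix (Fin n) (Fin n) ℝ) (hH : H ∈ Cr a c X Y) (U : Matrix (Fin n) (Fin n) ℝ)
    (hU : U ∈ OSet X ∩ OSet Y) (i j : Fin n) (hij : lamVec X i = lamVec X j)
    (hy : lamVec Y i ≠ lamVec Y j) : (Uᵀ * H * U) i j = 0 := by
  have hne : i ≠ j := fun h => hy (by rw [h])
  have hA := symm_conj' U H hH.1
  apply scal (lamVec Y i - lamVec Y j) ((Uᵀ * H * U) i i - (Uᵀ * H * U) j j) _ (sub_ne_zero.mpr hy)
  intro x hx
  have hxy : x ^ 2 + 1 ^ 2 ≠ 0 := by positivity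
  have h1 := cr_le_y a c hsym X Y hX hY U hU H hH _ (OSet_RR X U hU.1 i j hne x 1 hxy hij)
  rw [dg_RR, RR_dot i j hne x 1 hxy _ hA, mip_dg Y U H hY.1 hU.2] at h1
  have h2 : (lamVec Y ⬝ᵥ fun k => (Uᵀ * H * U) k k) = lamVec Y ⬝ᵥ dg U H := rfl
  rw [h2] at h1
  have h3 : 0 < 4 / (x ^ 2 + 1 ^ 2) ^ 2 := by positivity
  have h4 : 4 / (x ^ 2 + 1 ^ 2) ^ 2 * ((lamVec Y i - lamVec Y j) *
    (x * (-(x * ((Uᵀ * H * U) i i - (Uᵀ * H * U) j j)) + (x ^ 2 - 1) * (Uᵀ * H * U) i j))) ≤ 0 := by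
    simp only [mul_one, one_pow] at h1 ⊢
    linarith
  by_contra hc
  push Not at hc
  have := mul_pos h3 hc
  linarith

lemma nec_ii0 [NeZero p] (a : Fin p → Fin n → ℝ) (c : Fin p → ℝ)
    (hsym : ∀ (σ : Equiv.Perm (Fin n)) (x : Fin n → ℝ), pwa a c (x ∘ σ) = pwa a c x)
    (X Y : Matrix (Fin n) (Fin n) ℝ) (hX : X.IsSymm)
    (hY : Y ∈ msubdiff (fun X => pwa a c (lamVec X)) X)
    (H : Matrix (Fin n) (Fin n) ℝ) (hH : H ∈ Cr a c X Y) (U : Matrix (Fin n) (Fin n) ℝ)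
    (hU : U ∈ OSet X ∩ OSet Y) (i j : Fin n) (hij : lamVec X i = lamVec X j)
    (hy : lamVec Y i = lamVec Y j) (w : Fin p) (hw : w ∈ etaA a c (lamVec X) (lamVec Y))
    (hne : a w i ≠ a w j) :
    (Uᵀ * H * U) i i = (Uᵀ * H * U) j j ∧ (Uᵀ * H * U) i j = 0 := by
  have hn : i ≠ j := fun h => hne (by rw [h])
  have hA := symm_conj' U H hH.1
  have h0 := cr_eta a c hsym X Y hX hY H hH U hU w hw
  have key : ∀ x y : ℝ, x ^ 2 + y ^ 2 ≠ 0 → x * y * (-(x * y * ((Uᵀ * H * U) i i -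
      (Uᵀ * H * U) j j)) + (x ^ 2 - y ^ 2) * (Uᵀ * H * U) i j) = 0 := by
    intro x y hxy
    have h1 := cr_eta a c hsym X Y hX hY H hH _
      ⟨OSet_RR X U hU.1 i j hn x y hxy hij, OSet_RR Y U hU.2 i j hn x y hxy hy⟩ w hw
    rw [dg_RR, RR_dot i j hn x y hxy _ hA, ← h0] at h1
    have h2 : (a w ⬝ᵥ fun k => (Uᵀ * H * U) k k) = a w ⬝ᵥ dg U H := rfl
    rw [h2, add_eq_left] at h1
    rcases mul_eq_zero.mp h1 with h | h
    · have : 4 / (x ^ 2 + y ^ 2) ^ 2 ≠ 0 := by positivity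
      exact absurd h this
    · rcases mul_eq_zero.mp h with h | h
      · exact absurd (sub_eq_zero.mp h) hne
      · exact h
  have k1 := key 1 1 (by norm_num)
  have k2 := key 2 1 (by norm_num)
  constructor <;> linarith

lemma nec_ii [NeZero p] (a : Fin p → Fin n → ℝ) (c : Fin p → ℝ)
    (hsym : ∀ (σ : Equiv.Perm (Fin n)) (x : Fin n → ℝ), pwa a c (x ∘ σ) = pwa a c x)
    (X Y : Matrix (Fin n) (Fin n) ℝ) (hX : X.IsSymm)
    (hY : Y ∈ msubdiff (fun X => pwa a c (lamVec X)) X)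
    (H : Matrix (Fin n) (Fin n) ℝ) (hH : H ∈ Cr a c X Y) (U : Matrix (Fin n) (Fin n) ℝ)
    (hU : U ∈ OSet X ∩ OSet Y) (i j : Fin n) (hij : sameB X Y i j) (hn : i ≠ j)
    (hb : badB a c X Y i) :
    (Uᵀ * H * U) i i = (Uᵀ * H * U) j j ∧ (Uᵀ * H * U) i j = 0 := by
  obtain ⟨z, z', hz, hz', w, hw, hne⟩ := hb
  have hzz : z ≠ z' := fun h => hne (by rw [h])
  let σ : Equiv.Perm (Fin n) := Equiv.swap (Equiv.swap z i z') j * Equiv.swap z i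
  have hs : ∀ (l : Fin n → ℝ) (p q : Fin n), l p = l q → l ∘ Equiv.swap p q = l := by
    intro l p q h
    ext k
    simp only [Function.comp_apply, Equiv.swap_apply_def]
    split_ifs with h1 h2
    · rw [h1, h]
    · rw [h2, h]
    · rfl
  have hl : ∀ l : Fin n → ℝ, l z = l i → l z' = l i → l i = l j → l ∘ σ = l := by
    intro l h1 h2 h3
    have e1 := hs l z i h1
    have e2 := hs l (Equiv.swap z i z') j (by
      have := congrFun e1 z'
      simp only [Function.comp_apply] at this
      rw [this, h2, h3])
    change (l ∘ Equiv.swap (Equiv.swap z i z') j) ∘ Equiv.swap z i = l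
    rw [e2, e1]
  have hσ1 : σ z = i := by
    simp only [σ, Equiv.Perm.mul_apply, Equiv.swap_apply_left]
    apply Equiv.swap_apply_of_ne_of_ne
    · intro h
      apply hzz
      have := congrArg (Equiv.swap z i) h
      simpa using this
    · exact hn
  have hσ2 : σ z' = j := by
    simp only [σ, Equiv.Perm.mul_apply, Equiv.swap_apply_left]
  have hU' : U.submatrix id σ ∈ OSet X ∩ OSet Y :=
    ⟨OSet_perm X U hU.1 σ (hl _ hz.1 hz'.1 hij.1), OSet_perm Y U hU.2 σ (hl _ hz.2 hz'.2 hij.2)⟩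
  have := nec_ii0 a c hsym X Y hX hY H hH _ hU' z z' (hz.1.trans hz'.1.symm) (hz.2.trans hz'.2.symm)
    w hw hne
  rw [conj_perm] at this
  simpa only [submatrix_apply, hσ1, hσ2] using this

end

end S6

namespace S6

variable {n p : ℕ}

/-- Entry functional. -/
def ent (U : Matrix (Fin n) (Fin n) ℝ) (i j : Fin n) : Matrix (Fin n) (Fin n) ℝ →ₗ[ℝ] ℝ where
  toFun H := (Uᵀ * H * U) i j
  map_add' H K := by simp [Matrix.mul_add, Matrix.add_mul]
  map_smul' t H := by simp

/-- Diagonal functional. -/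
def dgf (U : Matrix (Fin n) (Fin n) ℝ) (w : Fin n → ℝ) : Matrix (Fin n) (Fin n) ℝ →ₗ[ℝ] ℝ where
  toFun H := dg U H ⬝ᵥ w
  map_add' H K := by rw [dg_add, add_dotProduct]
  map_smul' t H := by rw [dg_smul, smul_dotProduct]; rfl

lemma aff_van (C : Set (Matrix (Fin n) (Fin n) ℝ)) (f : Matrix (Fin n) (Fin n) ℝ →ₗ[ℝ] ℝ)
    (hf : ∀ H ∈ C, f H = 0) (H : Matrix (Fin n) (Fin n) ℝ) (hH : H ∈ affineSpan ℝ C) : f H = 0 := by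
  have h1 : H ∈ Submodule.span ℝ C := affineSpan_subset_span hH
  have h2 : Submodule.span ℝ C ≤ LinearMap.ker f := Submodule.span_le.mpr hf
  exact h2 h1

lemma span_aff (C : Set (Matrix (Fin n) (Fin n) ℝ)) (h0 : 0 ∈ C) (H : Matrix (Fin n) (Fin n) ℝ)
    (hH : H ∈ Submodule.span ℝ C) : H ∈ affineSpan ℝ C := by
  have := affineSpan_insert_zero (k := ℝ) C
  rw [insert_eq_of_mem h0] at this
  have h2 : H ∈ (affineSpan ℝ C : Set (Matrix (Fin n) (Fin n) ℝ)) := by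
    rw [this]; exact hH
  exact h2

section

lemma dg_conj' (U B : Matrix (Fin n) (Fin n) ℝ) (hU : Uᵀ * U = 1) :
    Uᵀ * (U * B * Uᵀ) * U = B := by
  calc Uᵀ * (U * B * Uᵀ) * U = (Uᵀ * U) * B * (Uᵀ * U) := by simp only [Matrix.mul_assoc]
    _ = B := by rw [hU]; simp

lemma mem_C [NeZero p] (a : Fin p → Fin n → ℝ) (c : Fin p → ℝ)
    (hsym : ∀ (σ : Equiv.Perm (Fin n)) (x : Fin n → ℝ), pwa a c (x ∘ σ) = pwa a c x)
    (X Y : Matrix (Fin n) (Fin n) ℝ) (hX : X.IsSymm)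
    (hY : Y ∈ msubdiff (fun X => pwa a c (lamVec X)) X)
    (U : Matrix (Fin n) (Fin n) ℝ) (hU : U ∈ OSet X ∩ OSet Y) (e : Fin n → ℝ)
    (K : Matrix (Fin n) (Fin n) ℝ)
    (he : ∀ i ∈ iotaA a c (lamVec X), a i ⬝ᵥ e ≤ lamVec Y ⬝ᵥ e) (hK : K.IsSymm)
    (hK0 : ∀ k l, lamVec X k = lamVec X l → K k l = 0) :
    U * (diagonal e + K) * Uᵀ ∈ Cr a c X Y := by
  have hS : (U * (diagonal e + K) * Uᵀ).IsSymm := symm_conj _ _ ((isSymm_diagonal e).add hK)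
  have hm : mip Y (U * (diagonal e + K) * Uᵀ) = lamVec Y ⬝ᵥ e := by
    rw [mip_dg Y U _ hY.1 hU.2]
    congr 1
    ext k
    unfold dg
    rw [dg_conj' U _ hU.1.1]
    simp [hK0 k k rfl]
  refine ⟨hS, ?_⟩
  rw [hm]
  apply crit_dd a c hsym X U K hX hU.1.1 hU.1.2 e _ he hK hK0
  intro t
  have := hY.2 (X + t • (U * (diagonal e + K) * Uᵀ)) (hX.add (hS.smul t))
  rw [add_sub_cancel_left, mip_dg Y U _ hY.1 hU.2, dg_smul, dotProduct_smul,
    ← mip_dg Y U _ hY.1 hU.2, hm] at this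
  exact this

lemma diag_C [NeZero p] (a : Fin p → Fin n → ℝ) (c : Fin p → ℝ)
    (hsym : ∀ (σ : Equiv.Perm (Fin n)) (x : Fin n → ℝ), pwa a c (x ∘ σ) = pwa a c x)
    (X Y : Matrix (Fin n) (Fin n) ℝ) (hX : X.IsSymm)
    (hY : Y ∈ msubdiff (fun X => pwa a c (lamVec X)) X)
    (U : Matrix (Fin n) (Fin n) ℝ) (hU : U ∈ OSet X ∩ OSet Y) (e : Fin n → ℝ)
    (he : ∀ i ∈ iotaA a c (lamVec X), a i ⬝ᵥ e ≤ lamVec Y ⬝ᵥ e) :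
    U * diagonal e * Uᵀ ∈ Cr a c X Y := by
  have := mem_C a c hsym X Y hX hY U hU e 0 he (isSymm_zero) (fun _ _ _ => rfl)
  rwa [add_zero] at this

lemma diag_mem [NeZero p] (a : Fin p → Fin n → ℝ) (c : Fin p → ℝ)
    (hsym : ∀ (σ : Equiv.Perm (Fin n)) (x : Fin n → ℝ), pwa a c (x ∘ σ) = pwa a c x)
    (X Y : Matrix (Fin n) (Fin n) ℝ) (hX : X.IsSymm)
    (hY : Y ∈ msubdiff (fun X => pwa a c (lamVec X)) X)
    (U : Matrix (Fin n) (Fin n) ℝ) (hU : U ∈ OSet X ∩ OSet Y) (e : Fin n → ℝ)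
    (he : ∀ i ∈ etaA a c (lamVec X) (lamVec Y), a i ⬝ᵥ e = lamVec Y ⬝ᵥ e) :
    U * diagonal e * Uᵀ ∈ Submodule.span ℝ (Cr a c X Y) := by
  obtain ⟨e0, h1, h2⟩ := exists_e0 a c (lamVec X) (lamVec Y) (y_rep a c hsym X Y hY U hU)
  have hev : ∀ᶠ t : ℝ in 𝓝[>] 0, ∀ j, j ∈ iotaA a c (lamVec X) →
      a j ⬝ᵥ (e0 + t • e) ≤ lamVec Y ⬝ᵥ (e0 + t • e) := by
    rw [eventually_all]
    intro j
    by_cases hj : j ∈ etaA a c (lamVec X) (lamVec Y)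
    · refine Eventually.of_forall fun t _ => ?_
      simp only [dotProduct_add, dotProduct_smul]
      rw [h1 j hj, he j hj]
    · by_cases hj' : j ∈ iotaA a c (lamVec X)
      · have hlt := h2 j hj' hj
        have hc : ∀ w : Fin n → ℝ, Continuous fun t : ℝ => w ⬝ᵥ (e0 + t • e) := by
          intro w
          simp only [dotProduct_add, dotProduct_smul, smul_eq_mul]
          fun_prop
        have := (hc (a j)).continuousAt.eventually_lt (x₀ := 0) (hc (lamVec Y)).continuousAt
          (by simpa using hlt)
        filter_upwards [nhdsWithin_le_nhds this] with t ht _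
        exact ht.le
      · exact Eventually.of_forall fun t h => absurd h hj'
  obtain ⟨t, ht, ht0⟩ := (hev.and self_mem_nhdsWithin).exists
  have ht0 : 0 < t := ht0
  have m1 := diag_C a c hsym X Y hX hY U hU _ ht
  have m0 := diag_C a c hsym X Y hX hY U hU e0 (by
    intro j hj
    by_cases hj' : j ∈ etaA a c (lamVec X) (lamVec Y)
    · exact (h1 j hj').le
    · exact (h2 j hj hj').le)
  have m2 := Submodule.smul_mem _ t⁻¹ (Submodule.sub_mem _ (Submodule.subset_span (R := ℝ) m1)
    (Submodule.subset_span m0))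
  convert m2 using 1
  have : diagonal (e0 + t • e) = diagonal e0 + t • diagonal e := by
    rw [← diagonal_smul, diagonal_add]; rfl
  rw [this, Matrix.mul_add, Matrix.add_mul, add_sub_cancel_left, Matrix.mul_smul, Matrix.smul_mul,
    smul_smul, inv_mul_cancel₀ ht0.ne', one_smul]

lemma off_mem [NeZero p] (a : Fin p → Fin n → ℝ) (c : Fin p → ℝ)
    (hsym : ∀ (σ : Equiv.Perm (Fin n)) (x : Fin n → ℝ), pwa a c (x ∘ σ) = pwa a c x)
    (X Y : Matrix (Fin n) (Fin n) ℝ) (hX : X.IsSymm)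
    (hY : Y ∈ msubdiff (fun X => pwa a c (lamVec X)) X)
    (U : Matrix (Fin n) (Fin n) ℝ) (hU : U ∈ OSet X ∩ OSet Y) (i j : Fin n) (hn : i ≠ j)
    (hij : sameB X Y i j) (hb : ¬ badB a c X Y i) :
    U * (Matrix.single i j (1:ℝ) + Matrix.single j i 1) * Uᵀ ∈
      Submodule.span ℝ (Cr a c X Y) := by
  have he : ∀ w ∈ etaA a c (lamVec X) (lamVec Y),
      a w ⬝ᵥ vv i j 1 (-1) = lamVec Y ⬝ᵥ vv i j 1 (-1) := by
    intro w hw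
    rw [dotProduct_comm, vv_dot, dotProduct_comm, vv_dot, hij.2]
    have : a w i = a w j := by
      by_contra h
      exact hb ⟨i, j, ⟨rfl, rfl⟩, ⟨hij.1.symm, hij.2.symm⟩, w, hw, h⟩
    rw [this]; ring
  have m1 := diag_mem a c hsym X Y hX hY U hU _ he
  have hxy : (2:ℝ) ^ 2 + 1 ^ 2 ≠ 0 := by norm_num
  have m2 := diag_mem a c hsym X Y hX hY (U * RR i j 2 1)
    ⟨OSet_RR X U hU.1 i j hn 2 1 hxy hij.1, OSet_RR Y U hU.2 i j hn 2 1 hxy hij.2⟩ _ he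
  have e1 : U * RR i j 2 1 * diagonal (vv i j 1 (-1)) * (U * RR i j 2 1)ᵀ =
      U * (RR i j 2 1 * diagonal (vv i j 1 (-1)) * RR i j 2 1) * Uᵀ := by
    rw [transpose_mul, RR_symm]; simp only [Matrix.mul_assoc]
  rw [e1, RR_off i j hn, Matrix.mul_add, Matrix.add_mul, Matrix.mul_smul, Matrix.smul_mul,
    Matrix.mul_smul, Matrix.smul_mul] at m2
  have m3 := (Submodule.add_mem_iff_right _ (Submodule.smul_mem _ _ m1)).mp m2
  exact (Submodule.smul_mem_iff _ (by norm_num)).mp m3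

lemma suff [NeZero p] (a : Fin p → Fin n → ℝ) (c : Fin p → ℝ)
    (hsym : ∀ (σ : Equiv.Perm (Fin n)) (x : Fin n → ℝ), pwa a c (x ∘ σ) = pwa a c x)
    (X Y : Matrix (Fin n) (Fin n) ℝ) (hX : X.IsSymm)
    (hY : Y ∈ msubdiff (fun X => pwa a c (lamVec X)) X)
    (U : Matrix (Fin n) (Fin n) ℝ) (hU : U ∈ OSet X ∩ OSet Y)
    (H : Matrix (Fin n) (Fin n) ℝ) (hH : H.IsSymm)
    (h1 : ∀ i j, sameA X i j → ¬ sameB X Y i j → (Uᵀ * H * U) i j = 0)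
    (h2 : ∀ i j, sameB X Y i j → badB a c X Y i → i ≠ j → (Uᵀ * H * U) i j = 0)
    (h3 : ∀ i ∈ etaA a c (lamVec X) (lamVec Y), ∀ j ∈ etaA a c (lamVec X) (lamVec Y),
      dg U H ⬝ᵥ (a i - a j) = 0) :
    H ∈ Submodule.span ℝ (Cr a c X Y) := by
  have hA := symm_conj' U H hH
  have hUU : U * Uᵀ = 1 := mul_eq_one_comm.mp hU.1.1
  have hHA : H = U * (Uᵀ * H * U) * Uᵀ := by
    calc H = (U * Uᵀ) * H * (U * Uᵀ) := by rw [hUU]; simp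
      _ = _ := by simp only [Matrix.mul_assoc]
  have hdA : dg U H = fun k => (Uᵀ * H * U) k k := rfl
  rw [hdA] at h3
  generalize Uᵀ * H * U = A at *
  subst hHA
  -- the diagonal part
  have md : U * diagonal (fun k => A k k) * Uᵀ ∈ Submodule.span ℝ (Cr a c X Y) := by
    apply diag_mem a c hsym X Y hX hY U hU
    intro i hi
    obtain ⟨u, g0, g1, g2, g3⟩ := y_rep a c hsym X Y hY U hU
    rw [wavg a u _ _ g3]
    have : ∀ j, u j * (a j ⬝ᵥ fun k => A k k) = u j * (a i ⬝ᵥ fun k => A k k) := by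
      intro j
      by_cases hj : u j = 0
      · simp [hj]
      · have hje : j ∈ etaA a c (lamVec X) (lamVec Y) :=
          ⟨u, g0, g1, g2, g3, lt_of_le_of_ne (g0 j) (Ne.symm hj)⟩
        have := h3 j hje i hi
        rw [dotProduct_sub, dotProduct_comm, dotProduct_comm _ (a i), sub_eq_zero] at this
        rw [this]
    rw [Finset.sum_congr rfl fun j _ => this j, ← Finset.sum_mul, g2, one_mul]
  -- the part inside the blocks
  let B : Matrix (Fin n) (Fin n) ℝ := Matrix.of fun k l =>
    if sameB X Y k l ∧ k ≠ l then A k l else 0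
  have hBs : Bᵀ = B := by
    ext k l
    simp only [B, transpose_apply, of_apply]
    have : (sameB X Y l k ∧ l ≠ k) ↔ (sameB X Y k l ∧ k ≠ l) :=
      ⟨fun h => ⟨⟨h.1.1.symm, h.1.2.symm⟩, h.2.symm⟩, fun h => ⟨⟨h.1.1.symm, h.1.2.symm⟩, h.2.symm⟩⟩
    simp only [this, hA.apply k l]
  have mB : U * B * Uᵀ ∈ Submodule.span ℝ (Cr a c X Y) := by
    have hB : B = (1 / 2 : ℝ) • ∑ k, ∑ l, B k l • (Matrix.single k l (1:ℝ) + Matrix.single l k 1) := by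
      have e1 : B = ∑ k, ∑ l, B k l • Matrix.single k l (1:ℝ) := by
        conv_lhs => rw [matrix_eq_sum_single B]
        simp
      have e2 : B = ∑ k, ∑ l, B k l • Matrix.single l k (1:ℝ) := by
        conv_lhs => rw [e1, Finset.sum_comm]
        refine Finset.sum_congr rfl fun k _ => Finset.sum_congr rfl fun l _ => ?_
        rw [← transpose_apply B, hBs]
      simp only [smul_add, Finset.sum_add_distrib]
      rw [← e1, ← smul_add, ← e2, ← two_smul ℝ B, smul_smul]
      norm_num
    rw [hB, Matrix.mul_smul, Matrix.smul_mul]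
    apply Submodule.smul_mem
    rw [Matrix.mul_sum, Matrix.sum_mul]
    apply Submodule.sum_mem
    intro k _
    rw [Matrix.mul_sum, Matrix.sum_mul]
    apply Submodule.sum_mem
    intro l _
    rw [Matrix.mul_smul, Matrix.smul_mul]
    by_cases hkl : sameB X Y k l ∧ k ≠ l
    · by_cases hb : badB a c X Y k
      · have : B k l = 0 := by
          simp only [B, of_apply, if_pos hkl]
          exact h2 k l hkl.1 hb hkl.2
        rw [this, zero_smul]
        exact Submodule.zero_mem _
      · exact Submodule.smul_mem _ _ (off_mem a c hsym X Y hX hY U hU k l hkl.2 hkl.1 hb)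
    · have : B k l = 0 := by simp only [B, of_apply, if_neg hkl]
      rw [this, zero_smul]
      exact Submodule.zero_mem _
  -- the part off the blocks
  let K : Matrix (Fin n) (Fin n) ℝ := Matrix.of fun k l => if sameA X k l then 0 else A k l
  have mK : U * K * Uᵀ ∈ Submodule.span ℝ (Cr a c X Y) := by
    apply Submodule.subset_span
    have := mem_C a c hsym X Y hX hY U hU 0 K (by simp) (by
      ext k l
      simp only [K, transpose_apply, of_apply]
      have : sameA X l k ↔ sameA X k l := ⟨Eq.symm, Eq.symm⟩
      simp only [this, hA.apply k l]) (by
      intro k l h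
      have h' : sameA X k l := h
      simp only [K, of_apply, if_pos h'])
    rwa [show diagonal (0 : Fin n → ℝ) = 0 from diagonal_zero, zero_add] at this
  have hsum : A = diagonal (fun k => A k k) + B + K := by
    ext k l
    simp only [Matrix.add_apply, diagonal_apply, B, K, of_apply]
    by_cases hkl : k = l
    · subst hkl
      have : sameA X k k := rfl
      simp [this]
    · by_cases ha : sameA X k l
      · by_cases hb : sameB X Y k l
        · simp [hkl, ha, hb]
        · simp [hkl, ha, hb, h1 k l ha hb]
      · have hb : ¬ sameB X Y k l := fun h => ha h.1
        simp [hkl, ha, hb]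
  have := Submodule.add_mem _ (Submodule.add_mem _ md mB) mK
  rw [← Matrix.add_mul, ← Matrix.mul_add, ← Matrix.add_mul, ← Matrix.mul_add, ← hsum] at this
  exact this

end

end S6
/-- Proposition 3.3.  A symmetric `H` belongs to the affine hull of the
critical cone `C(X̄+Ȳ; ∂θ₁(X̄))` iff: (i) each `Ūᵀ_{αˡ} H Ū_{αˡ}` is block diagonal w.r.t.
the blocks `βˡₖ`; (ii) on every bad block `k ∈ Eˡ` it is a multiple of the identity; and
(iii) `⟨diag(ŪᵀHŪ), aⁱ - aʲ⟩ = 0` for all `i, j ∈ η₁(λ(X̄),λ(Ȳ))`. -/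
theorem stmt6 {n p : ℕ} [NeZero p]
    (a : Fin p → Fin n → ℝ) (c : Fin p → ℝ)
    (hsym : ∀ (σ : Equiv.Perm (Fin n)) (x : Fin n → ℝ), pwa a c (x ∘ σ) = pwa a c x)
    (theta1 : Matrix (Fin n) (Fin n) ℝ → ℝ)
    (htheta1 : theta1 = fun X => pwa a c (lamVec X))
    (Xb : Matrix (Fin n) (Fin n) ℝ) (hXb : Xb.IsSymm)
    (Yb : Matrix (Fin n) (Fin n) ℝ) (hYb : Yb ∈ msubdiff theta1 Xb)
    (Ub : Matrix (Fin n) (Fin n) ℝ) (hUb : Ub ∈ OSet Xb ∩ OSet Yb)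
    (H : Matrix (Fin n) (Fin n) ℝ) (hH : H.IsSymm) :
    H ∈ affineSpan ℝ (critM1 theta1 Xb Yb) ↔
      ((∀ i j : Fin n, sameA Xb i j → ¬ sameB Xb Yb i j → (Ubᵀ * H * Ub) i j = 0) ∧
        (∃ ρ : Fin n → ℝ, (∀ i j : Fin n, sameB Xb Yb i j → ρ i = ρ j) ∧
          ∀ i j : Fin n, sameB Xb Yb i j → badB a c Xb Yb i →
            (Ubᵀ * H * Ub) i j = if i = j then ρ i else 0) ∧
        (∀ i ∈ etaA a c (lamVec Xb) (lamVec Yb), ∀ j ∈ etaA a c (lamVec Xb) (lamVec Yb),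
          (fun z => (Ubᵀ * H * Ub) z z) ⬝ᵥ (a i - a j) = 0)) := by
  subst htheta1
  have hYs := hYb.1
  change H ∈ affineSpan ℝ (S6.Cr a c Xb Yb) ↔ _
  constructor
  · intro hHa
    have hii : ∀ i j : Fin n, sameB Xb Yb i j → i ≠ j → badB a c Xb Yb i →
        (Ubᵀ * H * Ub) i i = (Ubᵀ * H * Ub) j j ∧ (Ubᵀ * H * Ub) i j = 0 := by
      intro i j hij hn hb
      constructor
      · have := S6.aff_van _ (S6.ent Ub i i - S6.ent Ub j j) (fun G hG => sub_eq_zero.mpr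
          (S6.nec_ii a c hsym Xb Yb hXb hYb G hG Ub hUb i j hij hn hb).1) H hHa
        exact sub_eq_zero.mp this
      · exact S6.aff_van _ (S6.ent Ub i j) (fun G hG =>
          (S6.nec_ii a c hsym Xb Yb hXb hYb G hG Ub hUb i j hij hn hb).2) H hHa
    refine ⟨?_, ?_, ?_⟩
    · intro i j hij hb
      exact S6.aff_van _ (S6.ent Ub i j) (fun G hG =>
        S6.nec_i a c hsym Xb Yb hXb hYb G hG Ub hUb i j hij fun h => hb ⟨hij, h⟩) H hHa
    · refine ⟨fun i => if badB a c Xb Yb i then (Ubᵀ * H * Ub) i i else 0, ?_, ?_⟩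
      · intro i j hij
        have hbb : badB a c Xb Yb i ↔ badB a c Xb Yb j := by
          constructor
          · rintro ⟨z, z', hz, hz', h⟩
            exact ⟨z, z', ⟨hz.1.trans hij.1, hz.2.trans hij.2⟩,
              ⟨hz'.1.trans hij.1, hz'.2.trans hij.2⟩, h⟩
          · rintro ⟨z, z', hz, hz', h⟩
            exact ⟨z, z', ⟨hz.1.trans hij.1.symm, hz.2.trans hij.2.symm⟩,
              ⟨hz'.1.trans hij.1.symm, hz'.2.trans hij.2.symm⟩, h⟩
        by_cases hb : badB a c Xb Yb i
        · simp only [if_pos hb, if_pos (hbb.mp hb)]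
          by_cases hn : i = j
          · rw [hn]
          · exact (hii i j hij hn hb).1
        · simp only [if_neg hb, if_neg (fun h => hb (hbb.mpr h))]
      · intro i j hij hb
        by_cases hn : i = j
        · subst hn
          simp only [if_pos hb, if_true]
        · rw [if_neg hn]
          exact (hii i j hij hn hb).2
    · intro i hi j hj
      refine S6.aff_van _ (S6.dgf Ub (a i - a j)) (fun G hG => ?_) H hHa
      have e1 := S6.cr_eta a c hsym Xb Yb hXb hYb G hG Ub hUb i hi
      have e2 := S6.cr_eta a c hsym Xb Yb hXb hYb G hG Ub hUb j hj
      change S6.dg Ub G ⬝ᵥ (a i - a j) = 0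
      rw [dotProduct_comm, sub_dotProduct, e1, e2, sub_self]
  · rintro ⟨h1, ⟨ρ, _, h2⟩, h3⟩
    apply S6.span_aff
    · have := S6.diag_C a c hsym Xb Yb hXb hYb Ub hUb 0 (by simp)
      simpa using this
    · refine S6.suff a c hsym Xb Yb hXb hYb Ub hUb H hH h1 ?_ h3
      intro i j hij hb hn
      rw [h2 i j hij hb, if_neg hn]

end
end
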